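/- arXiv:2511.14507 — 3 statements merged into one kernel-verified Lean document; each statement's English description precedes it below -/
import Mathlib

section
/- Let G be a (P₂ ∪ P₄, HVN)-free graph with ω(G) = ω ≥ 4, let A be an induced complete ω-partite subgraph of G of maximum order with parts A₁,…,A_ω, let H be the subgraph of G induced on V(G) ∖ V(A) and assume k = ω(H) ≥ 4, and let B be an induced complete k-partite subgraph of H of maximum order with parts B₁,…,B_k. If there exists a vertex v ∈ V(A) whose set of neighbours in V(B) intersects at least two of the parts B₁,…,B_k, then χ(G) ≤ ω + 2. -/
open SimpleGraph

/-- `P₂ ∪ P₄`: the disjoint union of a path on 2 vertices (vertices 0,1) and a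
path on 4 vertices (vertices 2,3,4,5). -/
def P2P4 : SimpleGraph (Fin 6) :=
  SimpleGraph.fromEdgeSet {s(0, 1), s(2, 3), s(3, 4), s(4, 5)}

/-- The HVN: `K₅` minus two edges incident to a common vertex; `{0,1,2,3}` is a
clique and vertex `4` is adjacent exactly to `0` and `1`. -/
def HVN : SimpleGraph (Fin 5) :=
  SimpleGraph.fromEdgeSet
    {s(0, 1), s(0, 2), s(0, 3), s(1, 2), s(1, 3), s(2, 3), s(4, 0), s(4, 1)}

/-- A graph `G` is `H`-free if it has no induced subgraph isomorphic to `H`,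
i.e. there is no graph embedding of `H` into `G`. -/
def IsFree {W V : Type*} (G : SimpleGraph V) (H : SimpleGraph W) : Prop :=
  IsEmpty (H ↪g G)

/-- `A` is an induced complete `m`-partite subgraph of `G` all of whose parts lie in `W`:
the parts are nonempty, pairwise disjoint, stable sets, and any two vertices in
different parts are adjacent. -/
def IsCompMultipartite {V : Type*} (G : SimpleGraph V) (W : Set V) {m : ℕ}
    (A : Fin m → Finset V) : Prop :=
  (∀ i, (A i).Nonempty) ∧
  (∀ i, ↑(A i) ⊆ W) ∧
  (∀ i j, i ≠ j → Disjoint (A i) (A j)) ∧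
  (∀ i, ∀ x ∈ A i, ∀ y ∈ A i, ¬ G.Adj x y) ∧
  (∀ i j, i ≠ j → ∀ x ∈ A i, ∀ y ∈ A j, G.Adj x y)

/-- `A` is an induced complete `m`-partite subgraph of `G` (with parts inside `W`)
of maximum order. -/
def IsMaxCompMultipartite {V : Type*} (G : SimpleGraph V) (W : Set V) {m : ℕ}
    (A : Fin m → Finset V) : Prop :=
  IsCompMultipartite G W A ∧
    ∀ B : Fin m → Finset V, IsCompMultipartite G W B →
      ∑ i, (B i).card ≤ ∑ i, (A i).card

/-- Six vertices inducing a `P₂ ∪ P₄` contradict `P₂ ∪ P₄`-freeness; the edge is `a b` and the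
path is `c d e f`. -/
theorem IsFree.no_edge_disjoint_path {V : Type*} {G : SimpleGraph V} (h : IsFree G P2P4)
    {a b c d e f : V} (hab : G.Adj a b) (hcd : G.Adj c d) (hde : G.Adj d e) (hef : G.Adj e f)
    (hce : ¬ G.Adj c e) (hcf : ¬ G.Adj c f) (hdf : ¬ G.Adj d f)
    (hac : ¬ G.Adj a c) (had : ¬ G.Adj a d) (hae : ¬ G.Adj a e) (haf : ¬ G.Adj a f)
    (hbc : ¬ G.Adj b c) (hbd : ¬ G.Adj b d) (hbe : ¬ G.Adj b e) (hbf : ¬ G.Adj b f) : False := by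
  have key : ∀ i j : Fin 6,
      G.Adj (![a, b, c, d, e, f] i) (![a, b, c, d, e, f] j) ↔ P2P4.Adj i j := by
    intro i j
    fin_cases i <;> fin_cases j <;> simp [P2P4, *, G.adj_comm]
  have hrow : ∀ i j : Fin 6, (∀ l, P2P4.Adj i l ↔ P2P4.Adj j l) → i = j := by
    simp only [P2P4, SimpleGraph.fromEdgeSet_adj, Set.mem_insert_iff, Set.mem_singleton_iff]
    decide
  refine h.false ⟨⟨![a, b, c, d, e, f], fun i j hij => hrow i j fun l => ?_⟩, @fun i j => key i j⟩
  rw [← key, ← key, hij]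

/-- Five vertices inducing an HVN contradict HVN-freeness. -/
theorem IsFree.no_hvn {V : Type*} {G : SimpleGraph V} (h : IsFree G HVN)
    {a b c d x : V} (hab : G.Adj a b) (hac : G.Adj a c) (had : G.Adj a d) (hbc : G.Adj b c)
    (hbd : G.Adj b d) (hcd : G.Adj c d) (hxa : G.Adj x a) (hxb : G.Adj x b)
    (hxc : ¬ G.Adj x c) (hxd : ¬ G.Adj x d) : False := by
  have key : ∀ i j : Fin 5,
      G.Adj (![a, b, c, d, x] i) (![a, b, c, d, x] j) ↔ HVN.Adj i j := by
    intro i j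
    fin_cases i <;> fin_cases j <;> simp [HVN, *, hab.symm, hac.symm, had.symm, hbc.symm,
      hbd.symm, hcd.symm, hxa.symm, hxb.symm, G.adj_comm _ x]
  have hrow : ∀ i j : Fin 5, (∀ l, HVN.Adj i l ↔ HVN.Adj j l) → i = j := by
    simp only [HVN, SimpleGraph.fromEdgeSet_adj, Set.mem_insert_iff, Set.mem_singleton_iff]
    decide
  refine h.false ⟨⟨![a, b, c, d, x], fun i j hij => hrow i j fun l => ?_⟩, @fun i j => key i j⟩
  rw [← key, ← key, hij]

/-- A graph without induced `P₄` on `S`, all of whose cliques inside `S` have at most `n` vertices,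
is `n`-colourable on `S`. -/
theorem exists_coloring_of_no_induced_path {V : Type*} (G : SimpleGraph V) (n : ℕ) (S : Finset V)
    (hP : ∀ a ∈ S, ∀ b ∈ S, ∀ c ∈ S, ∀ d ∈ S, G.Adj a b → G.Adj b c → G.Adj c d →
      ¬ G.Adj a c → ¬ G.Adj a d → ¬ G.Adj b d → False)
    (hS : ∀ K : Finset V, K ⊆ S → G.IsClique (K : Set V) → K.card ≤ n) :
    ∃ g : V → ℕ, (∀ x ∈ S, g x < n) ∧ ∀ x ∈ S, ∀ y ∈ S, G.Adj x y → g x ≠ g y := by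
  classical
  induction n generalizing S with
  | zero =>
    have : ∀ x, x ∉ S := fun x hx => by
      have := hS {x} (by simpa using hx) (by simp)
      simp at this
    exact ⟨fun _ => 0, fun x hx => absurd hx (this x), fun x hx => absurd hx (this x)⟩
  | succ n ih =>
    obtain ⟨T, hT, hTmax⟩ :=
      (S.powerset.filter fun T : Finset V => G.IsIndepSet (T : Set V)).exists_max_image
        Finset.card ⟨∅, by simp⟩
    simp only [Finset.mem_filter, Finset.mem_powerset] at hT hTmax
    obtain ⟨hTS, hTind⟩ := hT
    have hTadj : ∀ x ∈ T, ∀ y ∈ T, ¬ G.Adj x y := fun x hx y hy hxy => hTind hx hy hxy.ne hxy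
    have hdom : ∀ x ∈ S, x ∉ T → ∃ t ∈ T, G.Adj x t := by
      intro x hx hxT
      by_contra! hno
      have := hTmax (insert x T) ⟨Finset.insert_subset hx hTS, by
        rw [Finset.coe_insert]
        refine Set.Pairwise.insert hTind fun t ht _ => ⟨hno t ht, fun h => hno t ht h.symm⟩⟩
      rw [Finset.card_insert_of_notMem hxT] at this
      omega
    have hsmall : ∀ K : Finset V, K ⊆ S \ T → G.IsClique (K : Set V) → K.card ≤ n := by
      intro K hK hKc
      by_contra! hlt
      have hKS : K ⊆ S := hK.trans Finset.sdiff_subset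
      have hKT : ∀ x ∈ K, x ∉ T := fun x hx => (Finset.mem_sdiff.1 (hK hx)).2
      obtain ⟨x₀, hx₀⟩ : K.Nonempty := Finset.card_pos.1 (by omega)
      obtain ⟨t₀, ht₀, -⟩ := hdom x₀ (hKS hx₀) (hKT x₀ hx₀)
      obtain ⟨u, hu, humax⟩ := T.exists_max_image (fun u => (K.filter (G.Adj u)).card) ⟨t₀, ht₀⟩
      obtain ⟨c, hc, huc⟩ : ∃ c ∈ K, ¬ G.Adj u c := by
        by_contra! hall
        have := hS (insert u K) (Finset.insert_subset (hTS hu) hKS) (by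
          rw [Finset.coe_insert]
          exact hKc.insert fun b hb _ => hall b hb)
        rw [Finset.card_insert_of_notMem fun h => hKT u h hu] at this
        omega
      obtain ⟨u', hu', hcu'⟩ := hdom c (hKS hc) (hKT c hc)
      obtain ⟨b, hb, hub, hu'b⟩ : ∃ b ∈ K, G.Adj u b ∧ ¬ G.Adj u' b := by
        by_contra! hall
        have hlt' : (K.filter (G.Adj u)).card < (K.filter (G.Adj u')).card :=
          Finset.card_lt_card <| (Finset.ssubset_iff_of_subset fun y hy => by
            simp only [Finset.mem_filter] at hy ⊢
            exact ⟨hy.1, hall y hy.1 hy.2⟩).2 ⟨c, by simp [hc, hcu'.symm], by simp [huc]⟩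
        exact absurd (humax u' hu') (not_le.2 hlt')
      have hbc : b ≠ c := by rintro rfl; exact huc hub
      exact hP u (hTS hu) b (hKS hb) c (hKS hc) u' (hTS hu') hub (hKc hb hc hbc) hcu' huc
        (hTadj u hu u' hu') (fun h => hu'b h.symm)
    obtain ⟨g, hgn, hg⟩ := ih (S \ T)
      (fun a ha b hb c hc d hd => hP a (Finset.mem_sdiff.1 ha).1 b (Finset.mem_sdiff.1 hb).1
        c (Finset.mem_sdiff.1 hc).1 d (Finset.mem_sdiff.1 hd).1) hsmall
    refine ⟨fun x => if x ∈ T then n else g x, fun x hx => ?_, fun x hx y hy hxy => ?_⟩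
    · by_cases hxT : x ∈ T
      · simp [hxT]
      · have := hgn x (by simp [hx, hxT])
        simp only [hxT, if_false]
        omega
    · by_cases hxT : x ∈ T <;> by_cases hyT : y ∈ T
      · exact absurd hxy (hTadj x hxT y hyT)
      · have := hgn y (by simp [hy, hyT])
        simp only [hxT, hyT, if_true, if_false]
        omega
      · have := hgn x (by simp [hx, hxT])
        simp only [hxT, hyT, if_true, if_false]
        omega
      · simpa [hxT, hyT] using hg x (by simp [hx, hxT]) y (by simp [hy, hyT]) hxy

theorem Fin.exists_ne_three {n : ℕ} (hn : 4 ≤ n) (a b c : Fin n) :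
    ∃ d, d ≠ a ∧ d ≠ b ∧ d ≠ c := by
  obtain ⟨d, hd⟩ := Finset.exists_mem_notMem_of_card_lt_card
    (s := {a, b, c}) (t := (Finset.univ : Finset (Fin n)))
    (Finset.card_le_three.trans_lt (by simp; omega))
  exact ⟨d, by simpa using hd⟩

theorem Fin.exists_ne_four {n : ℕ} (hn : 5 ≤ n) (a b c d : Fin n) :
    ∃ e, e ≠ a ∧ e ≠ b ∧ e ≠ c ∧ e ≠ d := by
  obtain ⟨e, he⟩ := Finset.exists_mem_notMem_of_card_lt_card
    (s := {a, b, c, d}) (t := (Finset.univ : Finset (Fin n)))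
    (Finset.card_le_four.trans_lt (by simp; omega))
  exact ⟨e, by simpa using he⟩

/-- In an index set with at least four elements, one can find two indices other than `b` avoiding
the optional indices `p` and `q`, unless there are exactly four indices and `p`, `q` are distinct
genuine indices. -/
theorem Fin.exists_pair_ne {n : ℕ} (hn : 4 ≤ n) (b : Fin n) (p q : Option (Fin n))
    (h : ¬ (p ≠ q ∧ p ≠ none ∧ q ≠ none ∧ n = 4)) :
    ∃ i j, i ≠ j ∧ i ≠ b ∧ j ≠ b ∧ p ≠ some i ∧ p ≠ some j ∧ q ≠ some i ∧ q ≠ some j := by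
  have hget : ∀ (r : Option (Fin n)) (i : Fin n), i ≠ r.getD b → r ≠ some i := by
    rintro r i hi rfl
    exact hi rfl
  by_cases h5 : 5 ≤ n
  · obtain ⟨i, h1, h2, h3⟩ := Fin.exists_ne_three hn b (p.getD b) (q.getD b)
    obtain ⟨j, h4, h5, h6, h7⟩ := Fin.exists_ne_four h5 b (p.getD b) (q.getD b) i
    exact ⟨i, j, h7.symm, h1, h4, hget p i h2, hget p j h5, hget q i h3, hget q j h6⟩
  · obtain ⟨t, hp, hq⟩ : ∃ t, (∀ i, i ≠ t → p ≠ some i) ∧ (∀ i, i ≠ t → q ≠ some i) := by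
      rcases p with _ | p <;> rcases q with _ | q
      · exact ⟨b, by simp, by simp⟩
      · exact ⟨q, by simp, by simp [eq_comm]⟩
      · exact ⟨p, by simp [eq_comm], by simp⟩
      · have hpq : p = q := by
          by_contra hne
          exact h ⟨by simpa using hne, by simp, by simp, by omega⟩
        exact ⟨p, by simp [eq_comm], by simp [hpq, eq_comm]⟩
    obtain ⟨i, h1, h2, -⟩ := Fin.exists_ne_three hn b t t
    obtain ⟨j, h4, h5, h6⟩ := Fin.exists_ne_three hn b t i
    exact ⟨i, j, h6.symm, h1, h4, hp i h2, hp j h5, hq i h2, hq j h5⟩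

/-- Two complete multipartite families `A` and `B` in a `P₂ ∪ P₄`-free graph which, apart from the
exceptional parts `A α` and `B β`, have no edges between them and are complete to a common
vertex `v`.  Each vertex `x` of `R` has neighbours in at most one part of `A`; this part is recorded
by `I x` when it is not `A α`.  Likewise for `B`, `β` and `J`. -/
structure TwoSided {V : Type*} (G : SimpleGraph V) {w k : ℕ} (A : Fin w → Finset V)
    (B : Fin k → Finset V) (α : Fin w) (β : Fin k) (v : V) (R : Set V)
    (I : V → Option (Fin w)) (J : V → Option (Fin k)) : Prop where
  free : IsFree G P2P4
  hw : 4 ≤ w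
  hk : 4 ≤ k
  nonempty_left : ∀ i, (A i).Nonempty
  nonempty_right : ∀ j, (B j).Nonempty
  adj_left : ∀ i i', i ≠ i' → ∀ a ∈ A i, ∀ a' ∈ A i', G.Adj a a'
  adj_right : ∀ j j', j ≠ j' → ∀ b ∈ B j, ∀ b' ∈ B j', G.Adj b b'
  apex_left : ∀ i, i ≠ α → ∀ a ∈ A i, G.Adj v a
  apex_right : ∀ j, j ≠ β → ∀ b ∈ B j, G.Adj v b
  cross : ∀ i, i ≠ α → ∀ j, j ≠ β → ∀ a ∈ A i, ∀ b ∈ B j, ¬ G.Adj a b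
  not_adj_left : ∀ x ∈ R, ∀ i, i ≠ α → I x ≠ some i → ∀ a ∈ A i, ¬ G.Adj x a
  not_adj_right : ∀ x ∈ R, ∀ j, j ≠ β → J x ≠ some j → ∀ b ∈ B j, ¬ G.Adj x b
  exists_adj_left : ∀ x ∈ R, ∀ i, I x = some i → i ≠ α ∧ ∃ a ∈ A i, G.Adj x a
  exists_adj_right : ∀ x ∈ R, ∀ j, J x = some j → j ≠ β ∧ ∃ b ∈ B j, G.Adj x b
  apex_not_adj : ∀ x ∈ R, I x ≠ none → J x ≠ none → ¬ G.Adj x v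

namespace TwoSided

variable {V : Type*} {G : SimpleGraph V} {w k : ℕ} {A : Fin w → Finset V}
  {B : Fin k → Finset V} {α : Fin w} {β : Fin k} {v : V} {R : Set V}
  {I : V → Option (Fin w)} {J : V → Option (Fin k)}

theorem symm (F : TwoSided G A B α β v R I J) : TwoSided G B A β α v R J I where
  free := F.free
  hw := F.hk
  hk := F.hw
  nonempty_left := F.nonempty_right
  nonempty_right := F.nonempty_left
  adj_left := F.adj_right
  adj_right := F.adj_left
  apex_left := F.apex_right
  apex_right := F.apex_left
  cross j hj i hi b hb a ha h := F.cross i hi j hj a ha b hb h.symm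
  not_adj_left := F.not_adj_right
  not_adj_right := F.not_adj_left
  exists_adj_left := F.exists_adj_right
  exists_adj_right := F.exists_adj_left
  apex_not_adj x hx h h' := F.apex_not_adj x hx h' h

/-- An induced `P₄` anticomplete to two non-exceptional parts of `B` is impossible. -/
theorem no_path (F : TwoSided G A B α β v R I J) {j j' : Fin k} (hjj' : j ≠ j')
    {c d e f : V} (hcd : G.Adj c d) (hde : G.Adj d e) (hef : G.Adj e f)
    (hce : ¬ G.Adj c e) (hcf : ¬ G.Adj c f) (hdf : ¬ G.Adj d f)
    (h : ∀ x ∈ ({c, d, e, f} : Set V), ∀ b, b ∈ B j ∨ b ∈ B j' → ¬ G.Adj x b) : False := by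
  obtain ⟨b, hb⟩ := F.nonempty_right j
  obtain ⟨b', hb'⟩ := F.nonempty_right j'
  refine F.free.no_edge_disjoint_path (F.adj_right j j' hjj' b hb b' hb') hcd hde hef hce hcf hdf
    ?_ ?_ ?_ ?_ ?_ ?_ ?_ ?_ <;>
  first
  | exact fun hadj => h _ (by simp) b (Or.inl hb) hadj.symm
  | exact fun hadj => h _ (by simp) b' (Or.inr hb') hadj.symm

/-- Vertices of `R` with the same `J`-value induce no `P₄`. -/
theorem no_path_of_right_eq (F : TwoSided G A B α β v R I J) (o : Option (Fin k))
    {c d e f : V} (hc : c ∈ R) (hd : d ∈ R) (he : e ∈ R) (hf : f ∈ R)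
    (hoc : J c = o) (hod : J d = o) (hoe : J e = o) (hof : J f = o)
    (hcd : G.Adj c d) (hde : G.Adj d e) (hef : G.Adj e f)
    (hce : ¬ G.Adj c e) (hcf : ¬ G.Adj c f) (hdf : ¬ G.Adj d f) : False := by
  obtain ⟨j, j', hjj', hj, hj', h1, h2, -⟩ := Fin.exists_pair_ne F.hk β o o (by simp)
  refine F.no_path hjj' hcd hde hef hce hcf hdf ?_
  rintro x hx b (hb | hb) <;> rcases hx with rfl | rfl | rfl | rfl
  all_goals first
    | exact F.not_adj_right _ ‹_› j hj (by simp_all) b hb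
    | exact F.not_adj_right _ ‹_› j' hj' (by simp_all) b hb

theorem right_ne_of_adj_of_left_eq_some (F : TwoSided G A B α β v R I J) {x y : V} (hx : x ∈ R)
    (hy : y ∈ R) (hxy : G.Adj x y) {i : Fin w} (hi : I y = some i) (hxi : I x ≠ some i) :
    J x ≠ J y ∧ J x ≠ none ∧ J y ≠ none ∧ k = 4 := by
  by_contra hcon
  obtain ⟨j, j', hjj', hj, hj', h1, h2, h3, h4⟩ := Fin.exists_pair_ne F.hk β _ _ hcon
  obtain ⟨hiα, a, ha, hya⟩ := F.exists_adj_left y hy i hi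
  obtain ⟨l, hlα, hli, hlx⟩ := Fin.exists_ne_three F.hw α i ((I x).getD α)
  obtain ⟨a', ha'⟩ := F.nonempty_left l
  have hxl : I x ≠ some l := by
    intro h
    simp [h] at hlx
  refine F.no_path hjj' hxy hya (F.adj_left i l hli.symm a ha a' ha')
    (F.not_adj_left x hx i hiα hxi a ha) (F.not_adj_left x hx l hlα hxl a' ha')
    (F.not_adj_left y hy l hlα (by simpa [hi] using hli.symm) a' ha') ?_
  rintro z (rfl | rfl | rfl | rfl) b (hb | hb)
  · exact F.not_adj_right _ hx j hj h1 b hb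
  · exact F.not_adj_right _ hx j' hj' h2 b hb
  · exact F.not_adj_right _ hy j hj h3 b hb
  · exact F.not_adj_right _ hy j' hj' h4 b hb
  · exact F.cross i hiα j hj _ ha b hb
  · exact F.cross i hiα j' hj' _ ha b hb
  · exact F.cross l hlα j hj _ ha' b hb
  · exact F.cross l hlα j' hj' _ ha' b hb

/-- Adjacent vertices of `R` with different `I`-values have different genuine `J`-values. -/
theorem right_ne_of_adj (F : TwoSided G A B α β v R I J) {x y : V} (hx : x ∈ R)
    (hy : y ∈ R) (hxy : G.Adj x y) (hI : I x ≠ I y) :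
    J x ≠ J y ∧ J x ≠ none ∧ J y ≠ none ∧ k = 4 := by
  rcases hi : I y with _ | i
  · rcases hi' : I x with _ | i
    · exact absurd (hi'.trans hi.symm) hI
    · obtain ⟨h1, h2, h3, h4⟩ :=
        F.right_ne_of_adj_of_left_eq_some hy hx hxy.symm hi' (by simp [hi])
      exact ⟨h1.symm, h3, h2, h4⟩
  · exact F.right_ne_of_adj_of_left_eq_some hx hy hxy hi (hi ▸ hI)

/-- Adjacent vertices of `R` which do not agree in both `I` and `J` are both attached to
non-exceptional parts of `A` and of `B`, differ in both `I` and `J`, and both families have four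
parts. -/
theorem ne_of_adj (F : TwoSided G A B α β v R I J) {x y : V} (hx : x ∈ R)
    (hy : y ∈ R) (hxy : G.Adj x y) (h : I x ≠ I y ∨ J x ≠ J y) :
    (I x ≠ I y ∧ I x ≠ none ∧ I y ≠ none) ∧ (J x ≠ J y ∧ J x ≠ none ∧ J y ≠ none) ∧
      w = 4 ∧ k = 4 := by
  have hJ : I x ≠ I y → _ := F.right_ne_of_adj hx hy hxy
  have hI : J x ≠ J y → _ := F.symm.right_ne_of_adj hx hy hxy
  tauto

/-- If `p p'` is an edge of `R` with constant genuine `I` and `J`, then a vertex of `R` attached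
to non-exceptional parts of `A` and `B`, the latter different from that of `p`, is adjacent
to `p` or `p'`. -/
theorem adj_or_adj_of_right_ne (F : TwoSided G A B α β v R I J) {p p' x : V} (hp : p ∈ R)
    (hp' : p' ∈ R) (hx : x ∈ R) (hpp' : G.Adj p p') (hI : I p = I p') (hJ : J p = J p')
    (hIp : I p ≠ none) (hJp : J p ≠ none) (hIx : I x ≠ none) (hJx : J x ≠ none)
    (hne : J x ≠ J p) : G.Adj x p ∨ G.Adj x p' := by
  by_contra! hcon
  obtain ⟨i, hi⟩ := Option.ne_none_iff_exists'.1 hIp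
  obtain ⟨s, hs⟩ := Option.ne_none_iff_exists'.1 hIx
  obtain ⟨t, ht⟩ := Option.ne_none_iff_exists'.1 hJx
  obtain ⟨htβ, b, hb, hxb⟩ := F.exists_adj_right x hx t ht
  obtain ⟨m, hmα, hmi, hms⟩ := Fin.exists_ne_three F.hw α i s
  obtain ⟨a, ha⟩ := F.nonempty_left m
  have hpm : I p ≠ some m := by simpa [hi] using hmi.symm
  have hpt : J p ≠ some t := fun h => hne (ht.trans h.symm)
  exact F.free.no_edge_disjoint_path hpp' hxb (F.apex_right t htβ b hb).symm
    (F.apex_left m hmα a ha) (F.apex_not_adj x hx hIx hJx)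
    (F.not_adj_left x hx m hmα (by simpa [hs] using hms.symm) a ha)
    (fun h => F.cross m hmα t htβ a ha b hb h.symm)
    (fun h => hcon.1 h.symm) (F.not_adj_right p hp t htβ hpt b hb) (F.apex_not_adj p hp hIp hJp)
    (F.not_adj_left p hp m hmα hpm a ha)
    (fun h => hcon.2 h.symm) (F.not_adj_right p' hp' t htβ (hJ ▸ hpt) b hb)
    (F.apex_not_adj p' hp' (hI ▸ hIp) (hJ ▸ hJp))
    (F.not_adj_left p' hp' m hmα (hI ▸ hpm) a ha)

/-- Adjacent vertices of `R` attached to the same non-exceptional part of `A` and with the same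
`J`-value have the same neighbours in that part. -/
theorem adj_left_of_adj (F : TwoSided G A B α β v R I J) {p p' a : V} {i : Fin w} (hp : p ∈ R)
    (hp' : p' ∈ R) (hpp' : G.Adj p p') (hi : I p = some i) (hi' : I p' = some i)
    (hJ : J p = J p') (ha : a ∈ A i) (hpa : G.Adj p a) : G.Adj p' a := by
  by_contra hcon
  obtain ⟨hiα, -⟩ := F.exists_adj_left p hp i hi
  obtain ⟨j, j', hjj', hj, hj', h1, h2, -⟩ := Fin.exists_pair_ne F.hk β (J p) (J p) (by simp)
  obtain ⟨l, hlα, hli, -⟩ := Fin.exists_ne_three F.hw α i i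
  obtain ⟨a', ha'⟩ := F.nonempty_left l
  refine F.no_path hjj' hpp'.symm hpa (F.adj_left i l hli.symm a ha a' ha') hcon
    (F.not_adj_left p' hp' l hlα (by simpa [hi'] using hli.symm) a' ha')
    (F.not_adj_left p hp l hlα (by simpa [hi] using hli.symm) a' ha') ?_
  rintro z (rfl | rfl | rfl | rfl) b (hb | hb)
  · exact F.not_adj_right _ hp' j hj (hJ ▸ h1) b hb
  · exact F.not_adj_right _ hp' j' hj' (hJ ▸ h2) b hb
  · exact F.not_adj_right _ hp j hj h1 b hb
  · exact F.not_adj_right _ hp j' hj' h2 b hb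
  · exact F.cross i hiα j hj _ ha b hb
  · exact F.cross i hiα j' hj' _ ha b hb
  · exact F.cross l hlα j hj _ ha' b hb
  · exact F.cross l hlα j' hj' _ ha' b hb

/-- A vertex `b` of the exceptional part `B β` with neighbours in at most one part of `A`, and with
no neighbours among the vertices of `R` attached to another part of `B`. -/
structure IsPivot (G : SimpleGraph V) (A : Fin w → Finset V) (B : Fin k → Finset V) (β : Fin k)
    (R : Set V) (J : V → Option (Fin k)) (b : V) : Prop where
  mem : b ∈ B β
  not_adj : ∀ x ∈ R, J x ≠ none → ¬ G.Adj x b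
  left_unique : ∀ i i', ∀ a ∈ A i, ∀ a' ∈ A i', G.Adj b a → G.Adj b a' → i = i'

theorem pivot_adj_or_adj (F : TwoSided G A B α β v R I J) {b : V} (hb : IsPivot G A B β R J b)
    {x y a a' : V} {i l : Fin w} (hx : x ∈ R) (hy : y ∈ R) (hxy : G.Adj x y) (hi : I y = some i)
    (hxi : I x ≠ some i) (hxl : I x ≠ some l) (hil : i ≠ l) (hlα : l ≠ α) (ha : a ∈ A i)
    (hya : G.Adj y a) (ha' : a' ∈ A l) : G.Adj b a ∨ G.Adj b a' := by
  by_contra! hcon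
  obtain ⟨-, hJx, hJy, -⟩ := F.right_ne_of_adj hx hy hxy (hi ▸ hxi)
  obtain ⟨s, hs⟩ := Option.ne_none_iff_exists'.1 hJx
  obtain ⟨t, ht⟩ := Option.ne_none_iff_exists'.1 hJy
  obtain ⟨hiα, -⟩ := F.exists_adj_left y hy i hi
  obtain ⟨m, hmβ, hms, hmt⟩ := Fin.exists_ne_three F.hk β s t
  obtain ⟨c, hc⟩ := F.nonempty_right m
  exact F.free.no_edge_disjoint_path (F.adj_right β m hmβ.symm b hb.mem c hc) hxy hya
    (F.adj_left i l hil a ha a' ha') (F.not_adj_left x hx i hiα hxi a ha)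
    (F.not_adj_left x hx l hlα hxl a' ha')
    (F.not_adj_left y hy l hlα (by simpa [hi] using hil) a' ha')
    (fun h => hb.not_adj x hx hJx h.symm) (fun h => hb.not_adj y hy hJy h.symm) hcon.1 hcon.2
    (fun h => F.not_adj_right x hx m hmβ (by simpa [hs] using hms.symm) c hc h.symm)
    (fun h => F.not_adj_right y hy m hmβ (by simpa [ht] using hmt.symm) c hc h.symm)
    (fun h => F.cross i hiα m hmβ a ha c hc h.symm)
    (fun h => F.cross l hlα m hmβ a' ha' c hc h.symm)

/-- The pivot is complete to each non-exceptional part of `A` other than the parts of two adjacent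
vertices of `R` attached to different non-exceptional parts of `A`. -/
theorem pivot_adj (F : TwoSided G A B α β v R I J) {b : V} (hb : IsPivot G A B β R J b)
    {x y a : V} {l : Fin w} (hx : x ∈ R) (hy : y ∈ R) (hxy : G.Adj x y) (hI : I x ≠ I y)
    (hIx : I x ≠ none) (hIy : I y ≠ none) (hxl : I x ≠ some l) (hyl : I y ≠ some l) (hlα : l ≠ α)
    (ha : a ∈ A l) : G.Adj b a := by
  obtain ⟨i, hi⟩ := Option.ne_none_iff_exists'.1 hIx
  obtain ⟨i', hi'⟩ := Option.ne_none_iff_exists'.1 hIy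
  obtain ⟨-, c, hc, hxc⟩ := F.exists_adj_left x hx i hi
  obtain ⟨-, c', hc', hyc'⟩ := F.exists_adj_left y hy i' hi'
  rcases F.pivot_adj_or_adj hb hx hy hxy hi' (hi' ▸ hI) hxl (by simpa [hi'] using hyl) hlα hc'
    hyc' ha with h | h
  · rcases F.pivot_adj_or_adj hb hy hx hxy.symm hi (hi ▸ hI.symm) hyl (by simpa [hi] using hxl) hlα
      hc hxc ha with h' | h'
    · rw [hi, hi', hb.left_unique i i' c hc c' hc' h' h] at hI
      exact absurd rfl hI
    · exact h'
  · exact h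

/-- If `p p'` is an edge of `R` with constant genuine `I` and `J`, then each neighbour of `p` in `R`
with another `I`-value is a neighbour of `p'`. -/
theorem adj_of_adj_of_ne (F : TwoSided G A B α β v R I J) {b : V} (hb : IsPivot G A B β R J b)
    {p p' x : V} (hp : p ∈ R) (hp' : p' ∈ R) (hx : x ∈ R) (hpp' : G.Adj p p') (hI : I p = I p')
    (hJ : J p = J p') (hpx : G.Adj p x) (hne : I p ≠ I x) : G.Adj p' x := by
  by_contra hcon
  obtain ⟨⟨-, hIp, hIx⟩, ⟨-, hJp, hJx⟩, -⟩ := F.ne_of_adj hp hx hpx (Or.inl hne)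
  obtain ⟨i, hi⟩ := Option.ne_none_iff_exists'.1 hIp
  obtain ⟨i', hi'⟩ := Option.ne_none_iff_exists'.1 hIx
  obtain ⟨s, hs⟩ := Option.ne_none_iff_exists'.1 hJp
  obtain ⟨t, ht⟩ := Option.ne_none_iff_exists'.1 hJx
  obtain ⟨hiα', a, ha, hxa⟩ := F.exists_adj_left x hx i' hi'
  obtain ⟨l, hlα, hli, hli'⟩ := Fin.exists_ne_three F.hw α i i'
  obtain ⟨c, hc⟩ := F.nonempty_left l
  have hbc : G.Adj b c := F.pivot_adj hb hp hx hpx hne hIp hIx (by simpa [hi] using hli.symm)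
    (by simpa [hi'] using hli'.symm) hlα hc
  have hba : ¬ G.Adj b a := fun h => hli' (hb.left_unique l i' c hc a ha hbc h)
  obtain ⟨m, hmβ, hms, hmt⟩ := Fin.exists_ne_three F.hk β s t
  obtain ⟨d, hd⟩ := F.nonempty_right m
  have hpm : J p ≠ some m := by simpa [hs] using hms.symm
  exact F.free.no_edge_disjoint_path (F.adj_right β m hmβ.symm b hb.mem d hd) hpp'.symm hpx hxa
    hcon (F.not_adj_left p' hp' i' hiα' (by rw [← hI, ← hi']; exact hne) a ha)
    (F.not_adj_left p hp i' hiα' (by rw [← hi']; exact hne) a ha)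
    (fun h => hb.not_adj p' hp' (hJ ▸ hJp) h.symm) (fun h => hb.not_adj p hp hJp h.symm)
    (fun h => hb.not_adj x hx hJx h.symm) hba
    (fun h => F.not_adj_right p' hp' m hmβ (hJ ▸ hpm) d hd h.symm)
    (fun h => F.not_adj_right p hp m hmβ hpm d hd h.symm)
    (fun h => F.not_adj_right x hx m hmβ (by simpa [ht] using hmt.symm) d hd h.symm)
    (fun h => F.cross i' hiα' m hmβ a ha d hd h.symm)

/-- If `p p'` is an edge of `R` with constant genuine `I` and `J`, then each vertex of `R` attached
to non-exceptional parts of `A` and `B` which disagrees with `p` in `I` or `J` is adjacent to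
both `p` and `p'`. -/
theorem adj_and_adj_of_ne (F : TwoSided G A B α β v R I J) {b : V} (hb : IsPivot G A B β R J b)
    {p p' x : V} (hp : p ∈ R) (hp' : p' ∈ R) (hx : x ∈ R) (hpp' : G.Adj p p') (hI : I p = I p')
    (hJ : J p = J p') (hIp : I p ≠ none) (hJp : J p ≠ none) (hIx : I x ≠ none) (hJx : J x ≠ none)
    (hne : I p ≠ I x ∨ J p ≠ J x) : I p ≠ I x ∧ J p ≠ J x ∧ G.Adj p x ∧ G.Adj p' x := by
  have hor : G.Adj x p ∨ G.Adj x p' := by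
    rcases hne with h | h
    · exact F.symm.adj_or_adj_of_right_ne hp hp' hx hpp' hJ hI hJp hIp hJx hIx h.symm
    · exact F.adj_or_adj_of_right_ne hp hp' hx hpp' hI hJ hIp hJp hIx hJx h.symm
  rcases hor with h | h
  · obtain ⟨⟨hI', -⟩, ⟨hJ', -⟩, -⟩ := F.ne_of_adj hp hx h.symm hne
    exact ⟨hI', hJ', h.symm, F.adj_of_adj_of_ne hb hp hp' hx hpp' hI hJ h.symm hI'⟩
  · obtain ⟨⟨hI', -⟩, ⟨hJ', -⟩, -⟩ := F.ne_of_adj hp' hx h.symm (hI ▸ hJ ▸ hne)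
    exact ⟨hI ▸ hI', hJ ▸ hJ',
      F.adj_of_adj_of_ne hb hp' hp hx hpp'.symm hI.symm hJ.symm h.symm hI', h.symm⟩

/-- If `p p'` is an edge of `R` with constant genuine `I` and `J`, then the vertices of `R` attached
to non-exceptional parts of `A` and `B` which disagree with `p` in `I` or `J` form a stable set. -/
theorem not_adj_of_ne (F : TwoSided G A B α β v R I J) (hH : IsFree G HVN) {b : V}
    (hb : IsPivot G A B β R J b) {p p' x x' : V} (hp : p ∈ R) (hp' : p' ∈ R) (hx : x ∈ R)
    (hx' : x' ∈ R) (hpp' : G.Adj p p') (hI : I p = I p') (hJ : J p = J p') (hIp : I p ≠ none)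
    (hJp : J p ≠ none) (hIx : I x ≠ none) (hJx : J x ≠ none) (hIx' : I x' ≠ none)
    (hJx' : J x' ≠ none) (hne : I p ≠ I x ∨ J p ≠ J x) (hne' : I p ≠ I x' ∨ J p ≠ J x') :
    ¬ G.Adj x x' := by
  intro hxx'
  obtain ⟨hIpx, -, hpx, hp'x⟩ :=
    F.adj_and_adj_of_ne hb hp hp' hx hpp' hI hJ hIp hJp hIx hJx hne
  obtain ⟨hIpx', -, hpx', hp'x'⟩ :=
    F.adj_and_adj_of_ne hb hp hp' hx' hpp' hI hJ hIp hJp hIx' hJx' hne'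
  obtain ⟨i, hi⟩ := Option.ne_none_iff_exists'.1 hIp
  obtain ⟨s, hs⟩ := Option.ne_none_iff_exists'.1 hIx
  obtain ⟨t, ht⟩ := Option.ne_none_iff_exists'.1 hIx'
  by_cases hII : I x = I x'
  · obtain ⟨hiα, a, ha, hpa⟩ := F.exists_adj_left p hp i hi
    have hp'a := F.adj_left_of_adj hp hp' hpp' hi (hI ▸ hi) hJ ha hpa
    exact hH.no_hvn hpp' hpx hpx' hp'x hp'x' hxx' hpa.symm hp'a.symm
      (fun h => F.not_adj_left x hx i hiα (by rw [← hi]; exact hIpx.symm) a ha h.symm)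
      (fun h => F.not_adj_left x' hx' i hiα (by rw [← hi]; exact hIpx'.symm) a ha h.symm)
  · obtain ⟨hsα, a, ha, -⟩ := F.exists_adj_left x hx s hs
    obtain ⟨htα, c, hc, -⟩ := F.exists_adj_left x' hx' t ht
    have h1 : G.Adj b c := F.pivot_adj hb hp hx hpx hIpx hIp hIx (ht ▸ hIpx') (ht ▸ hII) htα hc
    have h2 : G.Adj b a :=
      F.pivot_adj hb hp hx' hpx' hIpx' hIp hIx' (hs ▸ hIpx) (hs ▸ Ne.symm hII) hsα ha
    have hst := hb.left_unique s t a ha c hc h2 h1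
    exact hII (by rw [hs, ht, hst])

/-- A colour `c` allowed for a vertex attached to the parts `o` of `A` and `o'` of `B`, when each
`A i` has colour `i`, each `B j` with `j ≠ β` has colour `f j`, and `B β` has colour `w`. -/
def ValidColor (α : Fin w) (f : Fin k → ℕ) (o : Option (Fin w)) (o' : Option (Fin k)) (c : ℕ) :
    Prop :=
  c < w + 2 ∧ (o = none → c ≠ α) ∧ (∀ i, o = some i → c ≠ i) ∧ (o' = none → c ≠ w) ∧
    ∀ j, o' = some j → c ≠ f j

/-- Replace the forbidden ones among the colours `0, …, w - 1` by colours that are allowed. -/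
def recolor (α : Fin w) (f : Fin k → ℕ) (o : Option (Fin w)) (o' : Option (Fin k)) (c : ℕ) : ℕ :=
  if c = α then w + 1 else if o.map Fin.val = some c then α else if o'.map f = some c then w else c

theorem recolor_injOn (α : Fin w) (f : Fin k → ℕ) (o : Option (Fin w)) (o' : Option (Fin k))
    {c d : ℕ} (hc : c < w) (hd : d < w) (h : recolor α f o o' c = recolor α f o o' d) : c = d := by
  have hα := α.isLt
  unfold recolor at h
  rcases o with _ | i <;> rcases o' with _ | j <;> simp at h <;> split_ifs at h <;> omega

theorem validColor_recolor {α : Fin w} {β : Fin k} {f : Fin k → ℕ} (hf : f.Injective)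
    (hfw : ∀ j, f j < w) (hfβ : f β = α) {o : Option (Fin w)} {o' : Option (Fin k)}
    (ho : o ≠ some α) (ho' : o' ≠ some β) {c : ℕ} (hc : c < w) :
    ValidColor α f o o' (recolor α f o o' c) := by
  have hα := α.isLt
  have hi : ∀ i, o = some i → (i : ℕ) ≠ α := by
    rintro i rfl h
    exact ho (congrArg some (Fin.ext h))
  have hj : ∀ j, o' = some j → f j ≠ α := by
    rintro j rfl h
    exact ho' (congrArg some (hf (h.trans hfβ.symm)))
  unfold recolor ValidColor
  rcases o with _ | i <;> rcases o' with _ | j <;> simp at hi hj ⊢ <;>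
    try have hjw := hfw j
  all_goals split_ifs <;> omega

/-- Three colours allowed for all vertices attached to non-exceptional parts of `A` and `B`. -/
def commonColor (α : Fin w) (n : ℕ) : ℕ := if n = 0 then α else w - 1 + n

theorem validColor_commonColor {α : Fin w} {β : Fin k} {f : Fin k → ℕ} (hf : f.Injective)
    (hfw : ∀ j, f j < w) (hfβ : f β = α) {o : Option (Fin w)} {o' : Option (Fin k)}
    (ho : o ≠ some α) (ho' : o' ≠ some β) (hn : o ≠ none) (hn' : o' ≠ none) {n : ℕ} (hc : n < 3) :
    ValidColor α f o o' (commonColor α n) := by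
  have hα := α.isLt
  obtain ⟨i, rfl⟩ := Option.ne_none_iff_exists'.1 hn
  obtain ⟨j, rfl⟩ := Option.ne_none_iff_exists'.1 hn'
  have hi : (i : ℕ) ≠ α := fun h => ho (congrArg some (Fin.ext h))
  have hj : f j ≠ α := fun h => ho' (congrArg some (hf (h.trans hfβ.symm)))
  have hjw := hfw j
  have hiw := i.isLt
  unfold commonColor ValidColor
  simp
  split_ifs <;> omega

theorem commonColor_injective (α : Fin w) : (commonColor α).Injective := by
  intro m n h
  have hα := α.isLt
  unfold commonColor at h
  split_ifs at h <;> omega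

theorem exists_coloring_class [Fintype V] (F : TwoSided G A B α β v R I J) (n : ℕ)
    (o : Option (Fin w)) (o' : Option (Fin k))
    (hK : ∀ K : Finset V, (∀ x ∈ K, x ∈ R ∧ I x = o ∧ J x = o') → G.IsClique (K : Set V) →
      K.card ≤ n) :
    ∃ g : V → ℕ, (∀ x ∈ R, I x = o → J x = o' → g x < n) ∧
      ∀ x ∈ R, ∀ y ∈ R, I x = o → I y = o → J x = o' → J y = o' → G.Adj x y → g x ≠ g y := by
  classical
  obtain ⟨g, hg, hg'⟩ := exists_coloring_of_no_induced_path G n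
    (Finset.univ.filter fun x => x ∈ R ∧ I x = o ∧ J x = o')
    (by
      simp only [Finset.mem_filter, Finset.mem_univ, true_and]
      intro a ha b hb c hc d hd
      exact F.no_path_of_right_eq o' ha.1 hb.1 hc.1 hd.1 ha.2.2 hb.2.2 hc.2.2 hd.2.2)
    (fun K hKS => hK K fun x hx => by simpa using hKS hx)
  simp only [Finset.mem_filter, Finset.mem_univ, true_and] at hg hg'
  exact ⟨g, fun x hx h h' => hg x ⟨hx, h, h'⟩,
    fun x hx y hy h1 h2 h3 h4 => hg' x ⟨hx, h1, h3⟩ y ⟨hy, h2, h4⟩⟩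

/-- The colouring of the vertices of `R` attached to non-exceptional parts of `A` and `B`, when both
families have four parts. -/
theorem exists_coloring_attached [Fintype V] (F : TwoSided G A B α β v R I J)
    (hH : IsFree G HVN) (hK : ∀ K : Finset V, G.IsClique (K : Set V) → K.card ≤ w)
    (hw : w = 4) {b : V} (hb : IsPivot G A B β R J b) {f : Fin k → ℕ} (hf : f.Injective)
    (hfw : ∀ j, f j < w) (hfβ : f β = α) :
    ∃ c : V → ℕ, (∀ x ∈ R, I x ≠ none → J x ≠ none → ValidColor α f (I x) (J x) (c x)) ∧
      ∀ x ∈ R, ∀ y ∈ R, I x ≠ none → J x ≠ none → I y ≠ none → J y ≠ none → G.Adj x y →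
        c x ≠ c y := by
  classical
  have hIα : ∀ x ∈ R, I x ≠ some α := fun x hx h => (F.exists_adj_left x hx α h).1 rfl
  have hJβ : ∀ x ∈ R, J x ≠ some β := fun x hx h => (F.exists_adj_right x hx β h).1 rfl
  by_cases hedge : ∃ p ∈ R, ∃ p' ∈ R, G.Adj p p' ∧ I p = I p' ∧ J p = J p' ∧ I p ≠ none ∧ J p ≠ none
  · obtain ⟨p, hp, p', hp', hpp', hI, hJ, hIp, hJp⟩ := hedge
    obtain ⟨g, hg, hg'⟩ := F.exists_coloring_class 3 (I p) (J p) fun K hKp hKc => by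
      by_contra! hlt
      obtain ⟨i, hi⟩ := Option.ne_none_iff_exists'.1 hIp
      obtain ⟨q, hq⟩ : K.Nonempty := Finset.card_pos.1 (by omega)
      obtain ⟨hqR, hqI, hqJ⟩ := hKp q hq
      obtain ⟨-, a, ha, hqa⟩ := F.exists_adj_left q hqR i (hqI.trans hi)
      have hall : ∀ x ∈ K, G.Adj a x := by
        intro x hx
        by_cases hxq : q = x
        · exact hxq ▸ hqa.symm
        · obtain ⟨hxR, hxI, hxJ⟩ := hKp x hx
          exact (F.adj_left_of_adj hqR hxR (hKc hq hx hxq) (hqI.trans hi) (hxI.trans hi)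
            (hqJ.trans hxJ.symm) ha hqa).symm
      have := hK (insert a K) (by
        rw [Finset.coe_insert]
        exact hKc.insert fun x hx _ => hall x hx)
      rw [Finset.card_insert_of_notMem fun h => G.loopless.irrefl a (hall a h)] at this
      omega
    have hthird : ∀ x, ∃ c : ℕ, c < 4 ∧ c ≠ α ∧ (∀ i, I x = some i → c ≠ i) ∧
        ∀ j, J x = some j → c ≠ f j := by
      intro x
      obtain ⟨c, hc, hc'⟩ := Finset.exists_mem_notMem_of_card_lt_card
        (s := {(α : ℕ), ((I x).map Fin.val).getD 0, ((J x).map f).getD 0}) (t := Finset.range 4)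
        (Finset.card_le_three.trans_lt (by simp))
      simp only [Finset.mem_insert, Finset.mem_singleton, not_or, Finset.mem_range] at hc hc'
      refine ⟨c, hc, hc'.1, fun i hi => ?_, fun j hj => ?_⟩
      · simpa [hi] using hc'.2.1
      · simpa [hj] using hc'.2.2
    choose t ht4 htα htI htJ using hthird
    have hne : ∀ x y, g x < 3 → commonColor α (g x) ≠ t y := by
      intro x y _ h
      have h1 := ht4 y
      have h2 := htα y
      unfold commonColor at h
      split_ifs at h <;> omega
    refine ⟨fun x => if I x = I p ∧ J x = J p then commonColor α (g x) else t x, ?_, ?_⟩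
    · intro x hx hIx hJx
      dsimp only
      split_ifs with h
      · exact validColor_commonColor hf hfw hfβ (hIα x hx) (hJβ x hx) hIx hJx (hg x hx h.1 h.2)
      · have := ht4 x
        exact ⟨by omega, fun h => absurd h hIx, htI x, fun h => absurd h hJx, htJ x⟩
    · intro x hx y hy hIx hJx hIy hJy hxy
      dsimp only
      split_ifs with h h' h'
      · exact fun he => hg' x hx y hy h.1 h'.1 h.2 h'.2 hxy (commonColor_injective α he)
      · exact hne x y (hg x hx h.1 h.2)
      · exact (hne y x (hg y hy h'.1 h'.2)).symm
      · refine absurd hxy (F.not_adj_of_ne hH hb hp hp' hx hy hpp' hI hJ hIp hJp hIx hJx hIy hJy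
          ?_ ?_) <;> grind
  · push Not at hedge
    refine ⟨fun x => commonColor α ((I x).elim 0 fun i => (i + 7 - α) % 4), ?_, ?_⟩
    · intro x hx hIx hJx
      refine validColor_commonColor hf hfw hfβ (hIα x hx) (hJβ x hx) hIx hJx ?_
      obtain ⟨i, hi⟩ := Option.ne_none_iff_exists'.1 hIx
      have hiα : (i : ℕ) ≠ α := fun h => hIα x hx (hi.trans (congrArg some (Fin.ext h)))
      have := i.isLt
      have := α.isLt
      simp only [hi, Option.elim_some]
      omega
    · intro x hx y hy hIx hJx hIy hJy hxy he
      have hIxy : I x ≠ I y := by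
        intro h
        by_cases hJxy : J x = J y
        · exact hJx (hedge x hx y hy hxy h hJxy hIx)
        · exact (F.ne_of_adj hx hy hxy (Or.inr hJxy)).1.1 h
      obtain ⟨i, hi⟩ := Option.ne_none_iff_exists'.1 hIx
      obtain ⟨i', hi'⟩ := Option.ne_none_iff_exists'.1 hIy
      have h := commonColor_injective α he
      simp only [hi, hi', Option.elim_some] at h
      have := i.isLt
      have := i'.isLt
      have := α.isLt
      exact hIxy (by rw [hi, hi', Fin.ext (show (i : ℕ) = i' by omega)])

/-- The vertices of `R` can be properly coloured with allowed colours. -/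
theorem exists_coloring [Fintype V] (F : TwoSided G A B α β v R I J)
    (hH : IsFree G HVN) (hK : ∀ K : Finset V, G.IsClique (K : Set V) → K.card ≤ w)
    {b : V} (hb : IsPivot G A B β R J b) {f : Fin k → ℕ} (hf : f.Injective)
    (hfw : ∀ j, f j < w) (hfβ : f β = α) :
    ∃ c : V → ℕ, (∀ x ∈ R, ValidColor α f (I x) (J x) (c x)) ∧
      ∀ x ∈ R, ∀ y ∈ R, G.Adj x y → c x ≠ c y := by
  classical
  have hIα : ∀ x ∈ R, I x ≠ some α := fun x hx h => (F.exists_adj_left x hx α h).1 rfl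
  have hJβ : ∀ x ∈ R, J x ≠ some β := fun x hx h => (F.exists_adj_right x hx β h).1 rfl
  choose g hg hg' using fun o o' =>
    F.exists_coloring_class w o o' fun K _ => hK K
  have hvalid : ∀ x ∈ R, ValidColor α f (I x) (J x) (recolor α f (I x) (J x) (g (I x) (J x) x)) :=
    fun x hx => validColor_recolor hf hfw hfβ (hIα x hx) (hJβ x hx) (hg _ _ x hx rfl rfl)
  have hproper : ∀ x ∈ R, ∀ y ∈ R, G.Adj x y → I x = I y → J x = J y →
      recolor α f (I x) (J x) (g (I x) (J x) x) ≠ recolor α f (I y) (J y) (g (I y) (J y) y) := by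
    intro x hx y hy hxy hI hJ he
    rw [← hI, ← hJ] at he
    exact hg' _ _ x hx y hy rfl hI.symm rfl hJ.symm hxy
      (recolor_injOn α f _ _ (hg _ _ x hx rfl rfl) (hg _ _ y hy hI.symm hJ.symm) he)
  by_cases hbad : ∃ x ∈ R, ∃ y ∈ R, G.Adj x y ∧ (I x ≠ I y ∨ J x ≠ J y)
  · obtain ⟨x₀, hx₀, y₀, hy₀, hxy₀, hne₀⟩ := hbad
    obtain ⟨c, hc, hc'⟩ := F.exists_coloring_attached hH hK
      (F.ne_of_adj hx₀ hy₀ hxy₀ hne₀).2.2.1 hb hf hfw hfβ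
    refine ⟨fun x => if I x ≠ none ∧ J x ≠ none then c x else
      recolor α f (I x) (J x) (g (I x) (J x) x), fun x hx => ?_, fun x hx y hy hxy => ?_⟩
    · dsimp only
      split_ifs with h
      · exact hc x hx h.1 h.2
      · exact hvalid x hx
    · dsimp only
      have hne := F.ne_of_adj hx hy hxy
      split_ifs with h h' h'
      · exact hc' x hx y hy h.1 h.2 h'.1 h'.2 hxy
      · grind
      · grind
      · exact hproper x hx y hy hxy (by grind) (by grind)
  · push Not at hbad
    exact ⟨_, hvalid, fun x hx y hy hxy =>
      hproper x hx y hy hxy (hbad x hx y hy hxy).1 (hbad x hx y hy hxy).2⟩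

end TwoSided

/-- In an HVN-free graph, a vertex with neighbours in two parts of a complete multipartite subgraph
with at least four parts and a nonneighbour in the part `C l` is complete to all parts but `C l`. -/
theorem IsCompMultipartite.adj_of_ne {V : Type*} {G : SimpleGraph V} (hH : IsFree G HVN)
    {W : Set V} {m : ℕ} (hm : 4 ≤ m) {C : Fin m → Finset V} (hC : IsCompMultipartite G W C)
    {x : V} {p q : Fin m} (hpq : p ≠ q) (hp : ∃ y ∈ C p, G.Adj x y) (hq : ∃ y ∈ C q, G.Adj x y)
    {l : Fin m} {c : V} (hc : c ∈ C l) (hxc : ¬ G.Adj x c) :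
    ∀ i, i ≠ l → ∀ y ∈ C i, G.Adj x y := by
  obtain ⟨hne, -, -, -, hadj⟩ := hC
  have claim : ∀ p q s t : Fin m, p ≠ q → s ≠ t → p ≠ s → p ≠ t → q ≠ s → q ≠ t →
      (∃ y ∈ C p, G.Adj x y) → (∃ y ∈ C q, G.Adj x y) → ∀ u ∈ C s, ∀ u' ∈ C t,
      ¬ G.Adj x u → G.Adj x u' := by
    rintro p q s t hpq hst hps hpt hqs hqt ⟨y, hy, hxy⟩ ⟨z, hz, hxz⟩ u hu u' hu' hxu
    by_contra hxu'
    exact hH.no_hvn (hadj p q hpq y hy z hz) (hadj p s hps y hy u hu) (hadj p t hpt y hy u' hu')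
      (hadj q s hqs z hz u hu) (hadj q t hqt z hz u' hu') (hadj s t hst u hu u' hu') hxy hxz hxu
      hxu'
  have main : ∀ p q : Fin m, p ≠ q → p ≠ l → q ≠ l →
      (∃ y ∈ C p, G.Adj x y) → (∃ y ∈ C q, G.Adj x y) → ∀ i, i ≠ l → ∀ y ∈ C i, G.Adj x y := by
    intro p q hpq hpl hql hp hq i hil y hy
    obtain ⟨s, hsl, hsp, hsq⟩ := Fin.exists_ne_three hm l p q
    obtain ⟨z, hz⟩ := hne s
    have hs : ∃ y ∈ C s, G.Adj x y :=
      ⟨z, hz, claim p q l s hpq hsl.symm hpl hsp.symm hql hsq.symm hp hq c hc z hz hxc⟩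
    by_cases hip : i = p
    · subst hip
      exact claim q s l i hsq.symm hil.symm hql hpq.symm hsl hsp hq hs c hc y hy hxc
    · by_cases hiq : i = q
      · subst hiq
        exact claim p s l i hsp.symm hil.symm hpl hpq hsl hsq hp hs c hc y hy hxc
      · exact claim p q l i hpq hil.symm hpl (Ne.symm hip) hql (Ne.symm hiq) hp hq c hc y hy hxc
  obtain ⟨s, hsp, hsq, -⟩ := Fin.exists_ne_three hm p q q
  obtain ⟨t, htp, htq, hts⟩ := Fin.exists_ne_three hm p q s
  have hst : (∃ y ∈ C s, G.Adj x y) ∨ ∃ y ∈ C t, G.Adj x y := by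
    obtain ⟨y, hy⟩ := hne s
    obtain ⟨z, hz⟩ := hne t
    by_cases hxy : G.Adj x y
    · exact Or.inl ⟨y, hy, hxy⟩
    · exact Or.inr ⟨z, hz, claim p q s t hpq hts.symm hsp.symm htp.symm hsq.symm htq.symm hp hq
        y hy z hz hxy⟩
  by_cases hpl : p = l
  · subst hpl
    rcases hst with h | h
    · exact main q s hsq.symm hpq.symm hsp hq h
    · exact main q t htq.symm hpq.symm htp hq h
  · by_cases hql : q = l
    · subst hql
      rcases hst with h | h
      · exact main p s hsp.symm hpq hsq hp h
      · exact main p t htp.symm hpq htq hp h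
    · exact main p q hpq hpl hql hp hq

/-- A choice of one vertex from each part of a complete multipartite subgraph is a clique. -/
theorem IsCompMultipartite.isClique_image {V : Type*} [DecidableEq V] {G : SimpleGraph V}
    {W : Set V} {m : ℕ} {C : Fin m → Finset V} (hC : IsCompMultipartite G W C) {y : Fin m → V}
    (hy : ∀ i, y i ∈ C i) :
    G.IsClique (Finset.univ.image y : Set V) ∧ (Finset.univ.image y).card = m := by
  obtain ⟨-, -, -, -, hadj⟩ := hC
  refine ⟨?_, ?_⟩
  · intro a ha b hb hab
    simp only [Finset.coe_image, Finset.coe_univ, Set.image_univ, Set.mem_range] at ha hb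
    obtain ⟨i, rfl⟩ := ha
    obtain ⟨j, rfl⟩ := hb
    exact hadj i j (fun h => hab (h ▸ rfl)) _ (hy i) _ (hy j)
  · rw [Finset.card_image_of_injective, Finset.card_univ, Fintype.card_fin]
    intro i j hij
    by_contra hne
    exact (hadj i j hne _ (hy i) _ (hy j)).ne hij

/-- A vertex of `W` outside a complete multipartite subgraph of maximum order, whose number of parts
is the clique number of `W`, has neighbours in at most one part. -/
theorem IsMaxCompMultipartite.eq_of_adj {V : Type*} {G : SimpleGraph V} (hH : IsFree G HVN)
    {W : Set V} {m : ℕ} (hm : 4 ≤ m) {C : Fin m → Finset V} (hC : IsMaxCompMultipartite G W C)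
    (hW : ∀ K : Finset V, (K : Set V) ⊆ W → G.IsClique (K : Set V) → K.card ≤ m)
    {x : V} (hx : x ∈ W) (hxC : ∀ i, x ∉ C i) :
    ∀ p q, ∀ y ∈ C p, ∀ z ∈ C q, G.Adj x y → G.Adj x z → p = q := by
  classical
  intro p q y hy z hz hxy hxz
  by_contra hpq
  obtain ⟨l, hl⟩ : ∃ l, ∀ u ∈ C l, ¬ G.Adj x u := by
    by_contra! hall
    choose u hu hxu using hall
    obtain ⟨hcl, hcard⟩ := hC.1.isClique_image hu
    have := hW (insert x (Finset.univ.image u))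
      (by
        intro a ha
        simp only [Finset.coe_insert, Finset.coe_image, Finset.coe_univ, Set.image_univ,
          Set.mem_insert_iff, Set.mem_range] at ha
        rcases ha with rfl | ⟨i, rfl⟩
        · exact hx
        · exact hC.1.2.1 i (hu i))
      (by
        rw [Finset.coe_insert]
        refine hcl.insert fun a ha _ => ?_
        simp only [Finset.coe_image, Finset.coe_univ, Set.image_univ, Set.mem_range] at ha
        obtain ⟨i, rfl⟩ := ha
        exact hxu i)
    rw [Finset.card_insert_of_notMem, hcard] at this
    · omega
    · simp only [Finset.mem_image, Finset.mem_univ, true_and, not_exists]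
      exact fun i h => hxC i (h ▸ hu i)
  obtain ⟨⟨hne, hsub, hdisj, hstab, hadj⟩, hmax⟩ := hC
  obtain ⟨c, hc⟩ := hne l
  have hcompl := IsCompMultipartite.adj_of_ne hH hm ⟨hne, hsub, hdisj, hstab, hadj⟩ hpq
    ⟨y, hy, hxy⟩ ⟨z, hz, hxz⟩ hc (hl c hc)
  have hmem : ∀ i a, a ∈ Function.update C l (insert x (C l)) i ↔ a ∈ C i ∨ (i = l ∧ a = x) := by
    intro i a
    by_cases hi : i = l
    · subst hi
      simp [or_comm]
    · simp [hi]
  have hlt : ∑ i, (C i).card < ∑ i, (Function.update C l (insert x (C l)) i).card := by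
    refine Finset.sum_lt_sum (fun i _ => Finset.card_le_card fun a ha => (hmem i a).2 (Or.inl ha))
      ⟨l, Finset.mem_univ l, ?_⟩
    simp [Finset.card_insert_of_notMem (hxC l)]
  refine absurd (hmax _ ⟨fun i => ?_, fun i a ha => ?_, fun i j hij => ?_, fun i a ha b hb => ?_,
    fun i j hij a ha b hb => ?_⟩) (not_le.2 hlt)
  · obtain ⟨a, ha⟩ := hne i
    exact ⟨a, (hmem i a).2 (Or.inl ha)⟩
  · rcases (hmem i a).1 ha with h | ⟨-, rfl⟩
    · exact hsub i h
    · exact hx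
  · rw [Finset.disjoint_left]
    intro a ha hb
    rcases (hmem i a).1 ha with h | ⟨rfl, rfl⟩ <;> rcases (hmem j a).1 hb with h' | ⟨rfl, h'⟩
    · exact Finset.disjoint_left.1 (hdisj i j hij) h h'
    · exact hxC i (h' ▸ h)
    · exact hxC j h'
    · exact hij rfl
  · rcases (hmem i a).1 ha with h | ⟨rfl, rfl⟩ <;> rcases (hmem i b).1 hb with h' | ⟨hil, h'⟩
    · exact hstab i a h b h'
    · subst hil h'
      exact fun hab => hl a h hab.symm
    · exact hl b h'
    · subst h'
      exact G.loopless.irrefl b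
  · rcases (hmem i a).1 ha with h | ⟨rfl, rfl⟩ <;> rcases (hmem j b).1 hb with h' | ⟨hjl, h'⟩
    · exact hadj i j hij a h b h'
    · subst hjl h'
      exact (hcompl i hij a h).symm
    · exact hcompl j hij.symm b h'
    · exact absurd hjl.symm hij

/-- If each vertex of `R` has neighbours in at most one of the sets `C i`, we can record that index,
ignoring the index `γ`. -/
theorem exists_attachment {V : Type*} (G : SimpleGraph V) {m : ℕ} (C : Fin m → Finset V)
    (γ : Fin m) (R : Set V)
    (h : ∀ x ∈ R, ∀ i j, ∀ y ∈ C i, ∀ z ∈ C j, G.Adj x y → G.Adj x z → i = j) :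
    ∃ I : V → Option (Fin m),
      (∀ x ∈ R, ∀ i, i ≠ γ → I x ≠ some i → ∀ a ∈ C i, ¬ G.Adj x a) ∧
      (∀ x ∈ R, ∀ i, I x = some i → i ≠ γ ∧ ∃ a ∈ C i, G.Adj x a) ∧
      ∀ x ∈ R, I x ≠ none → ∀ a ∈ C γ, ¬ G.Adj x a := by
  have hex : ∀ x : V, ∃ o : Option (Fin m), x ∈ R →
      (∀ i, i ≠ γ → o ≠ some i → ∀ a ∈ C i, ¬ G.Adj x a) ∧
      (∀ i, o = some i → i ≠ γ ∧ ∃ a ∈ C i, G.Adj x a) ∧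
      (o ≠ none → ∀ a ∈ C γ, ¬ G.Adj x a) := by
    intro x
    by_cases hx : ∃ i, i ≠ γ ∧ ∃ a ∈ C i, G.Adj x a
    · obtain ⟨i, hi, a, ha, hxa⟩ := hx
      refine ⟨some i, fun hxR => ⟨fun j _ hij b hb hxb => ?_, ?_, fun _ b hb hxb => ?_⟩⟩
      · exact hij (congrArg some (h x hxR i j a ha b hb hxa hxb))
      · rintro j hj
        obtain rfl := Option.some.inj hj
        exact ⟨hi, a, ha, hxa⟩
      · exact hi (h x hxR i γ a ha b hb hxa hxb)
    · push Not at hx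
      exact ⟨none, fun _ => ⟨fun i hi _ => hx i hi, by simp, by simp⟩⟩
  choose I hI using hex
  exact ⟨I, fun x hx => (hI x hx).1, fun x hx => (hI x hx).2.1, fun x hx => (hI x hx).2.2⟩

/-- Let `G` be a `(P₂ ∪ P₄, HVN)`-free graph with `ω(G) = ω ≥ 4`, let `A` be an
induced complete `ω`-partite subgraph of `G` of maximum order with parts
`A₁, …, A_ω`, let `H` be the subgraph of `G` induced on `V(G) ∖ V(A)` with
`k = ω(H) ≥ 4`, and let `B` be an induced complete `k`-partite subgraph of `H`
of maximum order with parts `B₁, …, B_k`.  If some vertex `v ∈ V(A)` has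
neighbours in at least two of the parts of `B`, then `χ(G) ≤ ω + 2`. -/
theorem chromatic_le_omega_add_two {V : Type*} [Fintype V] (G : SimpleGraph V)
    (h1 : IsFree G P2P4) (h2 : IsFree G HVN)
    (w : ℕ) (hw : 4 ≤ w) (hGw : G.cliqueNum = w)
    (A : Fin w → Finset V) (hA : IsMaxCompMultipartite G Set.univ A)
    (k : ℕ) (hk4 : 4 ≤ k)
    (hk : (G.induce (⋃ i, (↑(A i) : Set V))ᶜ).cliqueNum = k)
    (B : Fin k → Finset V)
    (hB : IsMaxCompMultipartite G (⋃ i, (↑(A i) : Set V))ᶜ B)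
    (v : V) (hv : v ∈ ⋃ i, (↑(A i) : Set V))
    (p q : Fin k) (hpq : p ≠ q)
    (hp : ∃ b ∈ B p, G.Adj v b) (hq : ∃ b ∈ B q, G.Adj v b) :
    G.chromaticNumber ≤ (w + 2 : ℕ) := by
  classical
  set U : Set V := (⋃ i, (↑(A i) : Set V))ᶜ with hU
  have hmemU : ∀ x, x ∈ U ↔ ∀ i, x ∉ A i := by
    intro x
    simp [hU]
  have hKG : ∀ K : Finset V, G.IsClique (K : Set V) → K.card ≤ w :=
    fun K hK => hGw ▸ hK.card_le_cliqueNum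
  have hKU : ∀ K : Finset V, (K : Set V) ⊆ U → G.IsClique (K : Set V) → K.card ≤ k := by
    intro K hKU hK
    have hcl : (G.induce U).IsClique (K.subtype (· ∈ U) : Set U) := by
      intro a ha b hb hab
      rw [Finset.mem_coe, Finset.mem_subtype] at ha hb
      exact hK ha hb fun h => hab (Subtype.ext h)
    have hcard := hcl.card_le_cliqueNum
    rw [hk, Finset.card_subtype, Finset.filter_true_of_mem fun x hx => hKU hx] at hcard
    exact hcard
  have hAuniq : ∀ x ∈ U, ∀ i j, ∀ y ∈ A i, ∀ z ∈ A j, G.Adj x y → G.Adj x z → i = j :=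
    fun x hx => hA.eq_of_adj h2 hw (fun K _ => hKG K) (Set.mem_univ x) ((hmemU x).1 hx)
  have hBuniq : ∀ x ∈ U, (∀ j, x ∉ B j) →
      ∀ i j, ∀ y ∈ B i, ∀ z ∈ B j, G.Adj x y → G.Adj x z → i = j :=
    fun x hx hxB => hB.eq_of_adj h2 hk4 hKU hx hxB
  obtain ⟨⟨hAne, -, -, hAstab, hAadj⟩, -⟩ := hA
  obtain ⟨α, hvα⟩ : ∃ α, v ∈ A α := by simpa using hv
  obtain ⟨β, hvβ⟩ : ∃ β, ∀ j, j ≠ β → ∀ b ∈ B j, G.Adj v b := by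
    by_cases hall : ∀ j, ∀ b ∈ B j, G.Adj v b
    · exact ⟨p, fun j _ => hall j⟩
    · push Not at hall
      obtain ⟨l, b, hb, hvb⟩ := hall
      exact ⟨l, hB.1.adj_of_ne h2 hk4 hpq hp hq hb hvb⟩
  have hkw : k ≤ w := by
    choose y hy using hB.1.1
    obtain ⟨hcl, hcard⟩ := hB.1.isClique_image hy
    exact hcard ▸ hKG _ hcl
  obtain ⟨⟨hBne, hBU, -, hBstab, hBadj⟩, -⟩ := hB
  have hcross : ∀ i, i ≠ α → ∀ j, j ≠ β → ∀ a ∈ A i, ∀ b ∈ B j, ¬ G.Adj a b :=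
    fun i hi j hj a ha b hb hab =>
      hi (hAuniq b (hBU j hb) i α a ha v hvα hab.symm (hvβ j hj b hb).symm)
  set R : Set V := {x | x ∈ U ∧ ∀ j, x ∉ B j} with hR
  obtain ⟨I, hI1, hI2, hI3⟩ := exists_attachment G A α R fun x hx => hAuniq x hx.1
  obtain ⟨J, hJ1, hJ2, hJ3⟩ := exists_attachment G B β R fun x hx => hBuniq x hx.1 hx.2
  have F : TwoSided G A B α β v R I J :=
    { free := h1
      hw := hw
      hk := hk4
      nonempty_left := hAne
      nonempty_right := hBne
      adj_left := hAadj
      adj_right := hBadj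
      apex_left := fun i hi a ha => hAadj α i hi.symm v hvα a ha
      apex_right := hvβ
      cross := hcross
      not_adj_left := hI1
      not_adj_right := hJ1
      exists_adj_left := hI2
      exists_adj_right := hJ2
      apex_not_adj := fun x hx h _ => hI3 x hx h v hvα }
  obtain ⟨b, hb⟩ := hBne β
  have hpivot : TwoSided.IsPivot G A B β R J b :=
    ⟨hb, fun x hx h => hJ3 x hx h b hb, hAuniq b (hBU β hb)⟩
  obtain ⟨f, hf, hfw, hfβ⟩ : ∃ f : Fin k → ℕ, f.Injective ∧ (∀ j, f j < w) ∧ f β = α :=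
    ⟨fun j => Equiv.swap (Fin.castLE hkw β) α (Fin.castLE hkw j),
      fun i j h => by simpa [← Fin.ext_iff] using h, fun j => Fin.isLt _, by simp⟩
  obtain ⟨c, hc, hcR⟩ := F.exists_coloring h2 hKG hpivot hf hfw hfβ
  have hcol : ∀ x, ∃ n : ℕ, n < w + 2 ∧ ((∃ i, x ∈ A i ∧ n = i) ∨
      (∃ j, x ∈ B j ∧ n = if j = β then w else f j) ∨ (x ∈ R ∧ n = c x)) := by
    intro x
    by_cases hxU : x ∈ U
    · by_cases hxB : ∀ j, x ∉ B j
      · exact ⟨c x, (hc x ⟨hxU, hxB⟩).1, Or.inr (Or.inr ⟨⟨hxU, hxB⟩, rfl⟩)⟩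
      · push Not at hxB
        obtain ⟨j, hj⟩ := hxB
        refine ⟨_, ?_, Or.inr (Or.inl ⟨j, hj, rfl⟩)⟩
        have := hfw j
        split_ifs <;> omega
    · rw [hmemU] at hxU
      push Not at hxU
      obtain ⟨i, hi⟩ := hxU
      exact ⟨i, by omega, Or.inl ⟨i, hi, rfl⟩⟩
  choose col hcolw hcol using hcol
  have hAB : ∀ i j, ∀ a ∈ A i, ∀ b ∈ B j, G.Adj a b → (i : ℕ) ≠ if j = β then w else f j := by
    intro i j a ha b hb hab
    have hi := i.isLt
    split_ifs with hj
    · omega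
    · have hiα : i = α := by
        by_contra hne
        exact hcross i hne j hj a ha b hb hab
      rw [hiα, ← hfβ]
      exact fun h => hj (hf h).symm
  have hAR : ∀ i, ∀ a ∈ A i, ∀ x ∈ R, G.Adj a x → (i : ℕ) ≠ c x := by
    intro i a ha x hx hax h
    by_cases hi : i = α
    · subst hi
      exact (hc x hx).2.1 (by_contra fun hne => hI3 x hx hne a ha hax.symm) h.symm
    · exact (hc x hx).2.2.1 i (by_contra fun hne => hI1 x hx i hi hne a ha hax.symm) h.symm
  have hBR : ∀ j, ∀ y ∈ B j, ∀ x ∈ R, G.Adj y x → (if j = β then w else f j) ≠ c x := by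
    intro j y hy x hx hyx h
    split_ifs at h with hj
    · subst hj
      exact (hc x hx).2.2.2.1 (by_contra fun hne => hJ3 x hx hne y hy hyx.symm) h.symm
    · exact (hc x hx).2.2.2.2 j (by_contra fun hne => hJ1 x hx j hj hne y hy hyx.symm) h.symm
  have hproper : ∀ x y, G.Adj x y → col x ≠ col y := by
    intro x y hxy
    rcases hcol x with ⟨i, hx, hcx⟩ | ⟨i, hx, hcx⟩ | ⟨hx, hcx⟩ <;>
      rcases hcol y with ⟨j, hy, hcy⟩ | ⟨j, hy, hcy⟩ | ⟨hy, hcy⟩ <;> rw [hcx, hcy]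
    · intro h
      rw [← Fin.ext h] at hy
      exact hAstab i x hx y hy hxy
    · exact hAB i j x hx y hy hxy
    · exact hAR i x hx y hy hxy
    · exact (hAB j i y hy x hx hxy.symm).symm
    · have hij : i ≠ j := by
        rintro rfl
        exact hBstab i x hx y hy hxy
      have hi := hfw i
      have hj := hfw j
      have hfij := hf.ne hij
      split_ifs with h h'
      · exact absurd (h.trans h'.symm) hij
      · omega
      · omega
      · exact hfij
    · exact hBR i x hx y hy hxy
    · exact (hAR j y hy x hx hxy.symm).symm
    · exact (hBR j y hy x hx hxy.symm).symm
    · exact hcR x hx y hy hxy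
  exact Colorable.chromaticNumber_le
    ⟨Coloring.mk (fun x => (⟨col x, hcolw x⟩ : Fin (w + 2))) fun {x y} hxy h =>
      hproper x y hxy (congrArg Fin.val h)⟩
end

section
/- Let G be a (P₂ ∪ P₄, HVN)-free graph with ω(G) = ω ≥ 4, let A be an induced complete ω-partite subgraph of G of maximum order with parts A₁,…,A_ω, let H be the subgraph of G induced on V(G) ∖ V(A) with k = ω(H) ≥ 4, and let B be an induced complete k-partite subgraph of H of maximum order with parts B₁,…,B_k. Assume that every vertex of V(A) has all its neighbours in V(B) inside at most one part of B. Let x, y ∈ V(G) ∖ (V(A) ∪ V(B)), write N_{A∪B}(z) for the set of neighbours of z lying in V(A) ∪ V(B), and suppose N_{A∪B}(x) ≠ N_{A∪B}(y) and that N_{A∪B}(x) ∪ N_{A∪B}(y) intersects at most three of the parts A₁,…,A_ω, B₁,…,B_k. Then x and y are not adjacent. -/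
open SimpleGraph

/-- `v` has neighbours in at most one of the sets `A i`. -/
def SeesAtMostOne {V : Type*} (G : SimpleGraph V) {m : ℕ} (A : Fin m → Finset V) (v : V) : Prop :=
  ∀ p q : Fin m, (∃ b ∈ A p, G.Adj v b) → (∃ b ∈ A q, G.Adj v b) → p = q

/-- The indices of the sets `A i` containing a neighbour of `x` or of `y`. -/
def metParts {V : Type*} (G : SimpleGraph V) {m : ℕ} (A : Fin m → Finset V) (x y : V) :
    Set (Fin m) :=
  {i | ∃ a ∈ A i, G.Adj x a ∨ G.Adj y a}

theorem metParts_comm {V : Type*} (G : SimpleGraph V) {m : ℕ} (A : Fin m → Finset V) (x y : V) :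
    metParts G A x y = metParts G A y x := by
  simp only [metParts, or_comm]

theorem not_isFree_P2P4 {V : Type*} {G : SimpleGraph V} (f : Fin 6 → V)
    (hf : ∀ i j, i < j → (G.Adj (f i) (f j) ↔ P2P4.Adj i j)) : ¬ IsFree G P2P4 := by
  have key : ∀ i j, G.Adj (f i) (f j) ↔ P2P4.Adj i j := by
    intro i j
    rcases lt_trichotomy i j with h | rfl | h
    · exact hf i j h
    · simp
    · rw [G.adj_comm, P2P4.adj_comm]; exact hf j i h
  have inj : Function.Injective f := by
    intro i j hij
    have h : ∀ l, P2P4.Adj i l ↔ P2P4.Adj j l := fun l => by rw [← key, ← key, hij]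
    revert h
    fin_cases i <;> fin_cases j <;> simp [P2P4, Fin.forall_fin_succ]
  exact fun h => h.false ⟨⟨f, inj⟩, fun {a b} => key a b⟩

theorem not_isFree_HVN {V : Type*} {G : SimpleGraph V} (f : Fin 5 → V)
    (hf : ∀ i j, i < j → (G.Adj (f i) (f j) ↔ HVN.Adj i j)) : ¬ IsFree G HVN := by
  have key : ∀ i j, G.Adj (f i) (f j) ↔ HVN.Adj i j := by
    intro i j
    rcases lt_trichotomy i j with h | rfl | h
    · exact hf i j h
    · simp
    · rw [G.adj_comm, HVN.adj_comm]; exact hf j i h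
  have inj : Function.Injective f := by
    intro i j hij
    have h : ∀ l, HVN.Adj i l ↔ HVN.Adj j l := fun l => by rw [← key, ← key, hij]
    revert h
    fin_cases i <;> fin_cases j <;> simp [HVN, Fin.forall_fin_succ]
  exact fun h => h.false ⟨⟨f, inj⟩, fun {a b} => key a b⟩

theorem IsFree.adj_of_P2P4 {V : Type*} {G : SimpleGraph V} (h : IsFree G P2P4)
    {p q a b c d : V} (hpq : G.Adj p q) (hab : G.Adj a b) (hbc : G.Adj b c) (hcd : G.Adj c d)
    (hac : ¬ G.Adj a c) (had : ¬ G.Adj a d) (hbd : ¬ G.Adj b d)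
    (hpa : ¬ G.Adj p a) (hpb : ¬ G.Adj p b) (hqa : ¬ G.Adj q a) (hqb : ¬ G.Adj q b) :
    G.Adj p c ∨ G.Adj p d ∨ G.Adj q c ∨ G.Adj q d := by
  by_contra! hc
  refine not_isFree_P2P4 ![p, q, a, b, c, d] ?_ h
  intro i j
  fin_cases i <;> fin_cases j <;> simp [P2P4, *]

theorem IsFree.adj_of_HVN {V : Type*} {G : SimpleGraph V} (h : IsFree G HVN)
    {v a b c d : V} (hab : G.Adj a b) (hac : G.Adj a c) (had : G.Adj a d) (hbc : G.Adj b c)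
    (hbd : G.Adj b d) (hcd : G.Adj c d) (hva : G.Adj v a) (hvb : G.Adj v b) :
    G.Adj v c ∨ G.Adj v d := by
  by_contra! hc
  have := hva.symm
  have := hvb.symm
  have h3 : ¬ G.Adj c v := fun h => hc.1 h.symm
  have h4 : ¬ G.Adj d v := fun h => hc.2 h.symm
  refine not_isFree_HVN ![a, b, c, d, v] ?_ h
  intro i j
  fin_cases i <;> fin_cases j <;> simp [HVN, *]

/-- A vertex outside a maximum complete `m`-partite subgraph, `m ≥ 4` the clique number, has
neighbours in at most one part. -/
theorem IsMaxCompMultipartite.seesAtMostOne {V : Type*} {G : SimpleGraph V} (h2 : IsFree G HVN)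
    {W : Set V} {m : ℕ} (hm : 4 ≤ m) {A : Fin m → Finset V} (hA : IsMaxCompMultipartite G W A)
    (hW : ∀ s : Finset V, ↑s ⊆ W → G.IsClique ↑s → s.card ≤ m)
    {v : V} (hvW : v ∈ W) (hv : ∀ i, v ∉ A i) : SeesAtMostOne G A v := by
  classical
  obtain ⟨⟨hne, hAW, hdisj, hst, hadj⟩, hmax⟩ := hA
  have transversal : ∀ t : Fin m → V, (∀ i, t i ∈ A i) → ∃ i, ¬ G.Adj v (t i) := by
    intro t ht
    by_contra! hc
    have htadj : ∀ i j, i ≠ j → G.Adj (t i) (t j) := fun i j hij =>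
      hadj i j hij _ (ht i) _ (ht j)
    have htinj : Function.Injective t := by
      intro i j hij
      by_contra hne
      exact (htadj i j hne).ne hij
    have hvt : v ∉ Finset.univ.image t := by
      simp only [Finset.mem_image, Finset.mem_univ, true_and, not_exists]
      exact fun i hi => (hc i).ne hi.symm
    have := hW (insert v (Finset.univ.image t)) ?_ ?_
    · rw [Finset.card_insert_of_notMem hvt, Finset.card_image_of_injective _ htinj] at this
      simp at this
    · intro u hu
      simp only [Finset.coe_insert, Finset.coe_image, Finset.coe_univ, Set.image_univ,
        Set.mem_insert_iff, Set.mem_range] at hu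
      rcases hu with rfl | ⟨i, rfl⟩
      · exact hvW
      · exact hAW i (ht i)
    · rw [Finset.coe_insert, isClique_insert]
      constructor
      · intro a ha b hb hab
        simp only [Finset.coe_image, Finset.coe_univ, Set.image_univ, Set.mem_range] at ha hb
        obtain ⟨i, rfl⟩ := ha
        obtain ⟨j, rfl⟩ := hb
        exact htadj i j fun h => hab (h ▸ rfl)
      · intro b hb _
        simp only [Finset.coe_image, Finset.coe_univ, Set.image_univ, Set.mem_range] at hb
        obtain ⟨j, rfl⟩ := hb
        exact hc j
  have two_two : ∀ p q r s, p ≠ q → p ≠ r → p ≠ s → q ≠ r → q ≠ s → r ≠ s →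
      ∀ a ∈ A p, ∀ b ∈ A q, ∀ c ∈ A r, ∀ d ∈ A s, G.Adj v a → G.Adj v b →
      ¬ G.Adj v c → G.Adj v d := by
    intro p q r s hpq hpr hps hqr hqs hrs a ha b hb c hc d hd hva hvb hvc
    exact (h2.adj_of_HVN (hadj p q hpq a ha b hb) (hadj p r hpr a ha c hc)
      (hadj p s hps a ha d hd) (hadj q r hqr b hb c hc) (hadj q s hqs b hb d hd)
      (hadj r s hrs c hc d hd) hva hvb).resolve_left hvc
  rintro p q ⟨a, ha, hva⟩ ⟨b, hb, hvb⟩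
  by_contra hpq
  choose t ht using hne
  obtain ⟨r, hr⟩ := transversal (Function.update (Function.update t p a) q b) (by
    intro i
    by_cases hiq : i = q
    · subst hiq; simpa using hb
    · by_cases hip : i = p
      · subst hip; simpa [hiq] using ha
      · simpa [hiq, hip] using ht i)
  have hrq : r ≠ q := by rintro rfl; simp [hvb] at hr
  have hrp : r ≠ p := by rintro rfl; simp [hrq, hva] at hr
  simp only [ne_eq, hrq, not_false_eq_true, Function.update_of_ne, hrp] at hr
  obtain ⟨s, hs⟩ : ∃ s, s ∉ ({p, q, r} : Finset (Fin m)) := by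
    by_contra! hc
    have h1 := Finset.card_le_card (fun i _ => hc i : Finset.univ ⊆ ({p, q, r} : Finset (Fin m)))
    have h3 := Finset.card_le_three (a := p) (b := q) (c := r)
    simp at h1
    omega
  simp only [Finset.mem_insert, Finset.mem_singleton, not_or] at hs
  obtain ⟨hsp, hsq, hsr⟩ := hs
  have hall : ∀ i, i ≠ r → ∀ d ∈ A i, G.Adj v d := by
    have hvs : G.Adj v (t s) := two_two p q r s hpq hrp.symm (Ne.symm hsp) hrq.symm (Ne.symm hsq)
      (Ne.symm hsr) a ha b hb _ (ht r) _ (ht s) hva hvb hr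
    intro i hir d hd
    by_cases hip : i = p
    · exact two_two q s r i (Ne.symm hsq) hrq.symm (by grind) hsr (by grind) hir.symm
        b hb _ (ht s) _ (ht r) d hd hvb hvs hr
    · by_cases hiq : i = q
      · exact two_two p s r i (Ne.symm hsp) hrp.symm (by grind) hsr (by grind) hir.symm
          a ha _ (ht s) _ (ht r) d hd hva hvs hr
      · exact two_two p q r i hpq hrp.symm (Ne.symm hip) hrq.symm (Ne.symm hiq) hir.symm
          a ha b hb _ (ht r) d hd hva hvb hr
  have hnone : ∀ c ∈ A r, ¬ G.Adj v c := by
    intro c hc hvc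
    obtain ⟨i, hi⟩ := transversal (Function.update t r c) (by
      intro i
      by_cases hir : i = r
      · subst hir; simpa using hc
      · simpa [hir] using ht i)
    by_cases hir : i = r
    · subst hir; simp [hvc] at hi
    · simp only [ne_eq, hir, not_false_eq_true, Function.update_of_ne] at hi
      exact hi (hall i hir _ (ht i))
  have hmem : ∀ i u, u ∈ Function.update A r (insert v (A r)) i ↔ u ∈ A i ∨ (i = r ∧ u = v) := by
    intro i u
    by_cases hir : i = r
    · subst hir; simp [or_comm]
    · simp [hir]
  have hle := hmax (Function.update A r (insert v (A r))) ⟨?_, ?_, ?_, ?_, ?_⟩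
  · have hlt : ∑ i, (A i).card < ∑ i, (Function.update A r (insert v (A r)) i).card := by
      refine Finset.sum_lt_sum (fun i _ => Finset.card_le_card ?_) ⟨r, Finset.mem_univ _, ?_⟩
      · intro u hu
        exact (hmem i u).2 (Or.inl hu)
      · simp [Finset.card_insert_of_notMem (hv r)]
    omega
  · exact fun i => ⟨t i, (hmem _ _).2 (Or.inl (ht i))⟩
  · intro i u hu
    rcases (hmem i u).1 hu with h | ⟨-, rfl⟩
    · exact hAW i h
    · exact hvW
  · intro i j hij
    rw [Finset.disjoint_left]
    intro u hu hu'
    have h := Finset.disjoint_left.1 (hdisj i j hij)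
    have := hv i
    have := hv j
    rw [hmem] at hu hu'
    grind
  · intro i u hu u' hu'
    rw [hmem] at hu hu'
    rcases hu with hu | ⟨rfl, rfl⟩ <;> rcases hu' with hu' | ⟨h, rfl⟩
    · exact hst i u hu u' hu'
    · subst h
      exact fun h => hnone u hu h.symm
    · exact hnone u' hu'
    · simp
  · intro i j hij u hu u' hu'
    rw [hmem] at hu hu'
    rcases hu with hu | ⟨rfl, rfl⟩ <;> rcases hu' with hu' | ⟨h, rfl⟩
    · exact hadj i j hij u hu u' hu'
    · subst h
      exact (hall i hij u hu).symm
    · exact hall j hij.symm u' hu'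
    · exact (hij h.symm).elim

/-- The configuration of two adjacent vertices `x`, `y` with transversals of four parts of one
complete multipartite graph and three parts of another cannot occur. -/
theorem IsFree.false_of_transversals {V : Type*} {G : SimpleGraph V} (h : IsFree G P2P4)
    {x y : V} (hxy : G.Adj x y) {a : Fin 4 → V} {b : Fin 3 → V}
    (ha : ∀ i j, i ≠ j → G.Adj (a i) (a j)) (hb : ∀ i j, i ≠ j → G.Adj (b i) (b j))
    (hab : ∀ i p q, G.Adj (b p) (a i) → G.Adj (b q) (a i) → p = q)
    (hba : ∀ p i j, G.Adj (b p) (a i) → G.Adj (b p) (a j) → i = j)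
    (hbx : ∀ p, ¬ G.Adj (b p) x) (hby : ∀ p, ¬ G.Adj (b p) y)
    (hx : ∀ i, i ≠ 1 → ¬ G.Adj x (a i)) (hy : ∀ i, i ≠ 0 → ¬ G.Adj y (a i))
    (hy0 : G.Adj y (a 0)) : False := by
  have sees_of_hit : ∀ i j, (∀ p q, p ≠ q →
      G.Adj (b p) (a i) ∨ G.Adj (b p) (a j) ∨ G.Adj (b q) (a i) ∨ G.Adj (b q) (a j)) →
      (∃ p, G.Adj (b p) (a i)) ∧ ∃ p, G.Adj (b p) (a j) := by
    intro i j hij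
    have h01 := hij 0 1 (by simp)
    have h02 := hij 0 2 (by simp)
    have h12 := hij 1 2 (by simp)
    have := hab i 0 1
    have := hab i 0 2
    have := hab i 1 2
    have := hab j 0 1
    have := hab j 0 2
    have := hab j 1 2
    grind
  have hit : ∀ i, i ≠ 0 → ¬ G.Adj x (a i) →
      (∃ p, G.Adj (b p) (a 0)) ∧ ∃ p, G.Adj (b p) (a i) :=
    fun i h0 hxi => sees_of_hit 0 i fun p q hpq => h.adj_of_P2P4 (hb p q hpq) hxy hy0
      (ha 0 i h0.symm) (hx 0 (by simp)) hxi (hy i h0) (hbx p) (hby p) (hbx q) (hby q)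
  have sees : ∀ i, ∃ p, G.Adj (b p) (a i) := by
    intro i
    by_cases h0 : i = 0
    · exact h0 ▸ (hit 2 (by simp) (hx 2 (by simp))).1
    by_cases hxi : G.Adj x (a i)
    · have h1 : i = 1 := by
        by_contra h1
        exact hx i h1 hxi
      subst h1
      exact (sees_of_hit 1 2 fun p q hpq => h.adj_of_P2P4 (hb p q hpq) hxy.symm hxi
        (ha 1 2 (by simp)) (hy 1 (by simp)) (hy 2 (by simp)) (hx 2 (by simp))
        (hby p) (hbx p) (hby q) (hbx q)).1
    · exact (hit i h0 hxi).2
  choose g hg using sees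
  have ginj : Function.Injective g := fun i j hij => hba (g i) i j (hg i) (hij ▸ hg j)
  simpa using Fintype.card_le_of_injective g ginj

theorem not_adj_of_metParts {V : Type*} {G : SimpleGraph V} (h1 : IsFree G P2P4)
    {w k : ℕ} (hw : 4 ≤ w) (hk : 4 ≤ k) {A : Fin w → Finset V} {B : Fin k → Finset V}
    (hAne : ∀ i, (A i).Nonempty) (hBne : ∀ i, (B i).Nonempty)
    (hA : ∀ i j, i ≠ j → ∀ x ∈ A i, ∀ y ∈ A j, G.Adj x y)
    (hB : ∀ i j, i ≠ j → ∀ x ∈ B i, ∀ y ∈ B j, G.Adj x y)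
    (hAB : ∀ i, ∀ v ∈ A i, SeesAtMostOne G B v) (hBA : ∀ i, ∀ v ∈ B i, SeesAtMostOne G A v)
    {x y z : V} (hxA : SeesAtMostOne G A x) (hyA : SeesAtMostOne G A y)
    (hmet : (metParts G B x y).ncard ≤ 1)
    {i₀ : Fin w} (hz : z ∈ A i₀) (hyz : G.Adj y z) (hxz : ¬ G.Adj x z) : ¬ G.Adj x y := by
  intro hxy
  have hy : ∀ i, i ≠ i₀ → ∀ u ∈ A i, ¬ G.Adj y u := fun i hi u hu hyu =>
    hi (hyA i i₀ ⟨u, hu, hyu⟩ ⟨z, hz, hyz⟩)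
  obtain ⟨i₁, h10, hx⟩ : ∃ i₁, i₁ ≠ i₀ ∧ ∀ i, i ≠ i₀ → i ≠ i₁ → ∀ u ∈ A i, ¬ G.Adj x u := by
    by_cases hex : ∃ i, i ≠ i₀ ∧ ∃ u ∈ A i, G.Adj x u
    · obtain ⟨i₁, h10, hu⟩ := hex
      exact ⟨i₁, h10, fun i _ hi1 u hu' hxu => hi1 (hxA i i₁ ⟨u, hu', hxu⟩ hu)⟩
    · have : Nontrivial (Fin w) := Fin.nontrivial_iff_two_le.2 (by omega)
      obtain ⟨i₁, h10⟩ := exists_ne i₀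
      exact ⟨i₁, h10, fun i hi _ u hu hxu => hex ⟨i, hi, u, hu, hxu⟩⟩
  obtain ⟨i₂, h2, i₃, h3, h23⟩ := Finset.one_lt_card.1
    (show 1 < (({i₀, i₁} : Finset (Fin w))ᶜ).card by
      rw [Finset.card_compl, Fintype.card_fin]
      have := Finset.card_le_two (a := i₀) (b := i₁)
      omega)
  simp only [Finset.mem_compl, Finset.mem_insert, Finset.mem_singleton, not_or] at h2 h3
  obtain ⟨h20, h21⟩ := h2
  obtain ⟨h30, h31⟩ := h3
  have hc : 2 < (metParts G B x y)ᶜ.ncard := by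
    have := Set.ncard_add_ncard_compl (metParts G B x y)
    rw [Nat.card_fin] at this
    omega
  obtain ⟨j₀, j₁, j₂, hj0, hj1, hj2, h01', h02', h12'⟩ := (Set.two_lt_ncard_iff).1 hc
  choose t ht using hAne
  choose s hs using hBne
  let σ : Fin 4 → Fin w := ![i₀, i₁, i₂, i₃]
  let τ : Fin 3 → Fin k := ![j₀, j₁, j₂]
  have hσ : Function.Injective σ := by
    intro i j
    fin_cases i <;> fin_cases j <;> simp [σ] <;> grind
  have hτ : Function.Injective τ := by
    intro i j
    fin_cases i <;> fin_cases j <;> simp [τ] <;> grind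
  have hτmet : ∀ p, τ p ∉ metParts G B x y := by
    intro p
    fin_cases p <;> assumption
  let t' := Function.update t i₀ z
  have ht' : ∀ i, t' i ∈ A i := by
    intro i
    by_cases hi : i = i₀
    · subst hi; simpa [t'] using hz
    · simpa [t', hi] using ht i
  have ht0 : t' i₀ = z := by simp [t']
  refine h1.false_of_transversals hxy (a := fun i => t' (σ i)) (b := fun p => s (τ p))
    (fun i j hij => hA _ _ (hσ.ne hij) _ (ht' _) _ (ht' _))
    (fun i j hij => hB _ _ (hτ.ne hij) _ (hs _) _ (hs _)) ?_ ?_ ?_ ?_ ?_ ?_ ?_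
  · intro i p q hp hq
    exact hτ (hAB _ _ (ht' (σ i)) _ _ ⟨_, hs _, hp.symm⟩ ⟨_, hs _, hq.symm⟩)
  · intro p i j hi hj
    exact hσ (hBA _ _ (hs (τ p)) _ _ ⟨_, ht' _, hi⟩ ⟨_, ht' _, hj⟩)
  · exact fun p h => hτmet p ⟨_, hs _, Or.inl h.symm⟩
  · exact fun p h => hτmet p ⟨_, hs _, Or.inr h.symm⟩
  · intro i hi
    by_cases h0 : i = 0
    · subst h0
      simpa [σ, ht0] using hxz
    · exact hx _ (hσ.ne h0) (hσ.ne hi) _ (ht' _)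
  · exact fun i hi => hy _ (hσ.ne hi) _ (ht' _)
  · simpa [σ, ht0] using hyz

/-- Vertices with different neighbourhoods in a complete multipartite graph `A` are
non-adjacent when few parts are met; symmetric in the two vertices. -/
theorem not_adj_of_distinguished {V : Type*} {G : SimpleGraph V} (h1 : IsFree G P2P4)
    {w k : ℕ} (hw : 4 ≤ w) (hk : 4 ≤ k) {A : Fin w → Finset V} {B : Fin k → Finset V}
    (hAne : ∀ i, (A i).Nonempty) (hBne : ∀ i, (B i).Nonempty)
    (hA : ∀ i j, i ≠ j → ∀ x ∈ A i, ∀ y ∈ A j, G.Adj x y)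
    (hB : ∀ i j, i ≠ j → ∀ x ∈ B i, ∀ y ∈ B j, G.Adj x y)
    (hAB : ∀ i, ∀ v ∈ A i, SeesAtMostOne G B v) (hBA : ∀ i, ∀ v ∈ B i, SeesAtMostOne G A v)
    {x y z : V} (hxA : SeesAtMostOne G A x) (hyA : SeesAtMostOne G A y)
    (hxB : SeesAtMostOne G B x) (hyB : SeesAtMostOne G B y)
    (hmet : (metParts G A x y).ncard + (metParts G B x y).ncard ≤ 3)
    {i₀ : Fin w} (hz : z ∈ A i₀) (hdist : ¬ (G.Adj x z ↔ G.Adj y z)) : ¬ G.Adj x y := by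
  by_cases hB1 : (metParts G B x y).ncard ≤ 1
  · by_cases hyz : G.Adj y z
    · exact not_adj_of_metParts h1 hw hk hAne hBne hA hB hAB hBA hxA hyA hB1 hz hyz
        (by tauto)
    · rw [metParts_comm] at hB1
      exact fun h => not_adj_of_metParts h1 hw hk hAne hBne hA hB hAB hBA hyA hxA hB1 hz
        (by tauto) hyz h.symm
  · obtain ⟨p, q, hp, hq, hpq⟩ := (Set.one_lt_ncard_iff).1 (not_le.1 hB1)
    have hA1 : (metParts G A x y).ncard ≤ 1 := by omega
    obtain ⟨b, hb, hxb | hyb⟩ := hp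
    · have hyb : ¬ G.Adj y b := by
        intro hyb
        obtain ⟨c, hc, hxc | hyc⟩ := hq
        · exact hpq (hxB p q ⟨b, hb, hxb⟩ ⟨c, hc, hxc⟩)
        · exact hpq (hyB p q ⟨b, hb, hyb⟩ ⟨c, hc, hyc⟩)
      rw [metParts_comm] at hA1
      exact fun h => not_adj_of_metParts h1 hk hw hBne hAne hB hA hBA hAB hyB hxB hA1 hb
        hxb hyb h.symm
    · have hxb : ¬ G.Adj x b := by
        intro hxb
        obtain ⟨c, hc, hxc | hyc⟩ := hq
        · exact hpq (hxB p q ⟨b, hb, hxb⟩ ⟨c, hc, hxc⟩)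
        · exact hpq (hyB p q ⟨b, hb, hyb⟩ ⟨c, hc, hyc⟩)
      exact not_adj_of_metParts h1 hk hw hBne hAne hB hA hBA hAB hxB hyB hA1 hb hyb hxb

/-- Claim 3.2 (non-adjacency, `ω ≥ 4`).  With `A`, `H`, `B` as in the paper
(`ω(G) = ω ≥ 4`, `k = ω(H) ≥ 4`, every vertex of `V(A)` has its `B`-neighbours
inside at most one part of `B`): if `x, y ∈ V(G) ∖ (V(A) ∪ V(B))` have
`N_{A∪B}(x) ≠ N_{A∪B}(y)` and `N_{A∪B}(x) ∪ N_{A∪B}(y)` intersects at most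
three of the parts `A₁, …, A_ω, B₁, …, B_k`, then `x` and `y` are not
adjacent. -/
theorem not_adj_of_neighbourhoods_meet_at_most_three_parts {V : Type*} [Fintype V]
    (G : SimpleGraph V) (h1 : IsFree G P2P4) (h2 : IsFree G HVN)
    (w : ℕ) (hw : 4 ≤ w) (hGw : G.cliqueNum = w)
    (A : Fin w → Finset V) (hA : IsMaxCompMultipartite G Set.univ A)
    (k : ℕ) (hk4 : 4 ≤ k)
    (hk : (G.induce (⋃ i, (↑(A i) : Set V))ᶜ).cliqueNum = k)
    (B : Fin k → Finset V)
    (hB : IsMaxCompMultipartite G (⋃ i, (↑(A i) : Set V))ᶜ B)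
    (hAB : ∀ v ∈ ⋃ i, (↑(A i) : Set V), ∀ p q : Fin k,
      (∃ b ∈ B p, G.Adj v b) → (∃ b ∈ B q, G.Adj v b) → p = q)
    (x y : V)
    (hx : x ∉ (⋃ i, (↑(A i) : Set V)) ∪ ⋃ j, (↑(B j) : Set V))
    (hy : y ∉ (⋃ i, (↑(A i) : Set V)) ∪ ⋃ j, (↑(B j) : Set V))
    (hne : G.neighborSet x ∩ ((⋃ i, (↑(A i) : Set V)) ∪ ⋃ j, (↑(B j) : Set V)) ≠
           G.neighborSet y ∩ ((⋃ i, (↑(A i) : Set V)) ∪ ⋃ j, (↑(B j) : Set V)))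
    (hthree : {i : Fin w | ∃ a ∈ A i, G.Adj x a ∨ G.Adj y a}.ncard +
              {j : Fin k | ∃ b ∈ B j, G.Adj x b ∨ G.Adj y b}.ncard ≤ 3) :
    ¬ G.Adj x y := by
  have hcl : ∀ s : Finset V, (s : Set V) ⊆ Set.univ → G.IsClique (s : Set V) → s.card ≤ w :=
    fun s _ hs => hGw ▸ IsClique.card_le_cliqueNum (tc := hs)
  have hclH : ∀ s : Finset V, (s : Set V) ⊆ (⋃ i, (↑(A i) : Set V))ᶜ →
      G.IsClique (s : Set V) → s.card ≤ k := by
    classical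
    intro s hsW hs
    have hcard : (s.subtype (· ∈ (⋃ i, (↑(A i) : Set V))ᶜ)).card = s.card := by
      rw [Finset.card_subtype, Finset.filter_true_of_mem fun u hu => hsW hu]
    rw [← hcard, ← hk]
    refine IsClique.card_le_cliqueNum (tc := ?_)
    intro u hu v hv huv
    simp only [Finset.mem_coe, Finset.mem_subtype] at hu hv
    exact hs hu hv fun h => huv (Subtype.ext h)
  have seesA : ∀ v, v ∉ (⋃ i, (↑(A i) : Set V)) → SeesAtMostOne G A v := fun v hv =>
    hA.seesAtMostOne h2 hw hcl (Set.mem_univ v) fun i hi => hv (Set.mem_iUnion.2 ⟨i, hi⟩)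
  have seesB : ∀ v, v ∉ (⋃ i, (↑(A i) : Set V)) ∪ ⋃ j, (↑(B j) : Set V) →
      SeesAtMostOne G B v := fun v hv =>
    hB.seesAtMostOne h2 hk4 hclH (fun h => hv (Or.inl h)) fun i hi =>
      hv (Or.inr (Set.mem_iUnion.2 ⟨i, hi⟩))
  have hxA := seesA x fun h => hx (Or.inl h)
  have hyA := seesA y fun h => hy (Or.inl h)
  have hxB := seesB x hx
  have hyB := seesB y hy
  have hBA : ∀ j, ∀ v ∈ B j, SeesAtMostOne G A v := fun j v hv => seesA v (hB.1.2.1 j hv)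
  have hAB' : ∀ i, ∀ v ∈ A i, SeesAtMostOne G B v := fun i v hv =>
    hAB v (Set.mem_iUnion.2 ⟨i, hv⟩)
  obtain ⟨z, hz, hdist⟩ : ∃ z ∈ (⋃ i, (↑(A i) : Set V)) ∪ ⋃ j, (↑(B j) : Set V),
      ¬ (G.Adj x z ↔ G.Adj y z) := by
    by_contra! hc
    refine hne (Set.ext fun z => ?_)
    simp only [Set.mem_inter_iff, mem_neighborSet]
    exact and_congr_left fun hz => hc z hz
  rcases hz with hz | hz
  · obtain ⟨i, hi⟩ := Set.mem_iUnion.1 hz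
    exact not_adj_of_distinguished h1 hw hk4 hA.1.1 hB.1.1 hA.1.2.2.2.2 hB.1.2.2.2.2
      hAB' hBA hxA hyA hxB hyB hthree hi hdist
  · obtain ⟨i, hi⟩ := Set.mem_iUnion.1 hz
    exact not_adj_of_distinguished h1 hk4 hw hB.1.1 hA.1.1 hB.1.2.2.2.2 hA.1.2.2.2.2
      hBA hAB' hxB hyB hxA hyA (by rw [add_comm]; exact hthree) hi hdist
end

section
/- Let G be a (P₂ ∪ P₄, HVN)-free graph with ω(G) = ω ≥ 5, let A be an induced complete ω-partite subgraph of G of maximum order with parts A₁,…,A_ω, let H be the subgraph of G induced on V(G) ∖ V(A) with k = ω(H) ≥ 4, and let B be an induced complete k-partite subgraph of H of maximum order with parts B₁,…,B_k. Assume that every vertex of V(A) has all its neighbours in V(B) inside at most one part of B. Let x, y ∈ V(G) ∖ (V(A) ∪ V(B)) be vertices such that x has all its A-neighbours in Aᵢ and all its B-neighbours in B_p (both nonempty), y has all its A-neighbours in Aⱼ and all its B-neighbours in B_q (both nonempty), with i ≠ j and p ≠ q. Then x and y are not adjacent. -/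
open SimpleGraph

/-- A map that preserves and reflects adjacency from a graph without twins is an embedding. -/
theorem IsFree.false_of_adj_iff {W V : Type*} {G : SimpleGraph V} {H : SimpleGraph W}
    (h : IsFree G H) (hH : ∀ u v, (∀ z, H.Adj u z ↔ H.Adj v z) → u = v) (f : W → V)
    (hf : ∀ u v, G.Adj (f u) (f v) ↔ H.Adj u v) : False :=
  h.false ⟨⟨f, fun u v huv => hH u v fun z => by rw [← hf, ← hf, huv]⟩, hf _ _⟩

theorem IsFree.false_of_P2P4 {V : Type*} {G : SimpleGraph V} (h : IsFree G P2P4)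
    {a b u v s t : V} (hab : G.Adj a b) (huv : G.Adj u v) (hvs : G.Adj v s) (hst : G.Adj s t)
    (hus : ¬ G.Adj u s) (hut : ¬ G.Adj u t) (hvt : ¬ G.Adj v t)
    (ha : ¬ G.Adj u a ∧ ¬ G.Adj v a ∧ ¬ G.Adj s a ∧ ¬ G.Adj t a)
    (hb : ¬ G.Adj u b ∧ ¬ G.Adj v b ∧ ¬ G.Adj s b ∧ ¬ G.Adj t b) : False := by
  refine h.false_of_adj_iff (fun c d hcd => ?_) ![a, b, u, v, s, t] fun c d => ?_
  · simp only [P2P4, Fin.forall_fin_succ, fromEdgeSet_adj] at hcd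
    fin_cases c <;> fin_cases d <;> simp at hcd ⊢
  · fin_cases c <;> fin_cases d <;> simp [P2P4] <;> simp_all [G.adj_comm]

theorem IsFree.false_of_HVN {V : Type*} {G : SimpleGraph V} (h : IsFree G HVN)
    {a b c d v : V} (hab : G.Adj a b) (hac : G.Adj a c) (had : G.Adj a d) (hbc : G.Adj b c)
    (hbd : G.Adj b d) (hcd : G.Adj c d) (hva : G.Adj v a) (hvb : G.Adj v b)
    (hvc : ¬ G.Adj v c) (hvd : ¬ G.Adj v d) : False := by
  refine h.false_of_adj_iff (fun e f hef => ?_) ![a, b, c, d, v] fun e f => ?_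
  · simp only [HVN, Fin.forall_fin_succ, fromEdgeSet_adj] at hef
    fin_cases e <;> fin_cases f <;> simp at hef ⊢
  · fin_cases e <;> fin_cases f <;> simp [HVN] <;> simp_all [G.adj_comm]

theorem Fin.exists_notMem_of_card_lt {n : ℕ} (s : Finset (Fin n)) (hs : s.card < n) :
    ∃ m, m ∉ s := by
  by_contra! h
  have := Finset.card_le_card (fun m _ => h m : Finset.univ ⊆ s)
  simp at this
  omega

/-- In a graph with clique number `w`, a vertex has no neighbour in some part of a
complete `w`-partite subgraph. -/
theorem IsCompMultipartite.exists_part_not_adj {V : Type*} [Fintype V] {G : SimpleGraph V}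
    {W : Set V} {w : ℕ} (hGw : G.cliqueNum = w) {A : Fin w → Finset V}
    (hA : IsCompMultipartite G W A) (v : V) : ∃ n, ∀ a ∈ A n, ¬ G.Adj v a := by
  classical
  by_contra! h
  choose f hfA hvf using h
  have hff : ∀ s t, s ≠ t → G.Adj (f s) (f t) := fun s t hst =>
    hA.2.2.2.2 s t hst _ (hfA s) _ (hfA t)
  have hinj : Function.Injective f := fun s t hst => by
    by_contra hne
    exact (hff s t hne).ne hst
  have hcl : G.IsClique (insert v (Finset.univ.image f) : Finset V) := by
    intro a ha b hb hab
    simp only [Finset.coe_insert, Finset.coe_image, Finset.coe_univ, Set.image_univ,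
      Set.mem_insert_iff, Set.mem_range] at ha hb
    rcases ha with rfl | ⟨s, rfl⟩ <;> rcases hb with rfl | ⟨t, rfl⟩
    · exact absurd rfl hab
    · exact hvf t
    · exact (hvf s).symm
    · exact hff s t fun h => hab (h ▸ rfl)
  have hle := hcl.card_le_cliqueNum
  rw [Finset.card_insert_of_notMem, Finset.card_image_of_injective _ hinj, hGw] at hle
  · simp at hle
  · simp only [Finset.mem_image, Finset.mem_univ, true_and, not_exists]
    exact fun s hs => (hvf s).ne hs.symm

/-- A vertex outside a maximum complete multipartite subgraph is not simultaneously
anticomplete to one part and complete to all the others. -/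
theorem IsMaxCompMultipartite.false_of_complete {V : Type*} {G : SimpleGraph V}
    {w : ℕ} {A : Fin w → Finset V} (hA : IsMaxCompMultipartite G Set.univ A) {v : V}
    (hv : ∀ t, v ∉ A t) {n : Fin w} (hn : ∀ a ∈ A n, ¬ G.Adj v a)
    (hc : ∀ m, m ≠ n → ∀ a ∈ A m, G.Adj v a) : False := by
  classical
  obtain ⟨⟨hne, -, hdis, hst, hadj⟩, hmax⟩ := hA
  let C : Fin w → Finset V := Function.update A n (insert v (A n))
  have hCn : C n = insert v (A n) := Function.update_self ..
  have hCm : ∀ m, m ≠ n → C m = A m := fun m hm => Function.update_of_ne hm ..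
  have hmem : ∀ m a, a ∈ C m → a ∈ A m ∨ (m = n ∧ a = v) := by
    intro m a ha
    by_cases hm : m = n
    · subst hm
      rw [hCn, Finset.mem_insert] at ha
      tauto
    · exact .inl (hCm m hm ▸ ha)
  have hCadj : ∀ s t, s ≠ t → ∀ a ∈ C s, ∀ b ∈ C t, G.Adj a b := by
    intro s t hs a ha b hb
    rcases hmem s a ha with ha | ⟨rfl, rfl⟩ <;> rcases hmem t b hb with hb | ⟨rfl, rfl⟩
    · exact hadj s t hs a ha b hb
    · exact (hc s hs a ‹_›).symm
    · exact hc t hs.symm b hb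
    · exact absurd rfl hs
  have hle := hmax C ⟨fun m => ?_, fun _ => Set.subset_univ _, fun s t hs => ?_, ?_, hCadj⟩
  · refine hle.not_gt (Finset.sum_lt_sum (fun m _ => ?_) ⟨n, Finset.mem_univ _, ?_⟩)
    · by_cases hm : m = n
      · subst hm
        rw [hCn]
        exact Finset.card_le_card (Finset.subset_insert _ _)
      · rw [hCm m hm]
    · rw [hCn, Finset.card_insert_of_notMem (hv n)]
      exact Nat.lt_succ_self _
  · by_cases hm : m = n
    · subst hm
      rw [hCn]
      exact Finset.insert_nonempty _ _
    · rw [hCm m hm]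
      exact hne m
  · exact Finset.disjoint_left.2 fun a ha hb => G.loopless.irrefl a (hCadj s t hs a ha a hb)
  · intro m a ha b hb
    rcases hmem m a ha with ha | ⟨rfl, rfl⟩ <;> rcases hmem m b hb with hb | ⟨hm, rfl⟩
    · exact hst m a ha b hb
    · subst hm
      exact fun h => hn a ‹_› h.symm
    · exact hn b hb
    · exact G.loopless.irrefl _

/-- In an HVN-free graph of clique number `w ≥ 5`, a vertex outside a maximum complete
`w`-partite subgraph has all its neighbours in that subgraph inside a single part. -/
theorem IsMaxCompMultipartite.part_eq_of_adj {V : Type*} [Fintype V] {G : SimpleGraph V}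
    (h2 : IsFree G HVN) {w : ℕ} (hw : 5 ≤ w) (hGw : G.cliqueNum = w) {A : Fin w → Finset V}
    (hA : IsMaxCompMultipartite G Set.univ A) {v : V} (hv : ∀ t, v ∉ A t) {s t : Fin w}
    {a b : V} (ha : a ∈ A s) (hb : b ∈ A t) (hva : G.Adj v a) (hvb : G.Adj v b) : s = t := by
  by_contra hst
  obtain ⟨n, hn⟩ := hA.1.exists_part_not_adj hGw v
  obtain ⟨c, hc⟩ := hA.1.1 n
  have hadj := hA.1.2.2.2.2
  have key : ∀ s t m a b d, s ≠ t → m ≠ n → m ≠ s → m ≠ t → a ∈ A s → b ∈ A t → d ∈ A m →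
      G.Adj v a → G.Adj v b → G.Adj v d := by
    intro s t m a b d hst hmn hms hmt ha hb hd hva hvb
    by_contra hvd
    have hns : n ≠ s := fun h => hn a (h ▸ ha) hva
    have hnt : n ≠ t := fun h => hn b (h ▸ hb) hvb
    exact h2.false_of_HVN (hadj s t hst a ha b hb) (hadj s n hns.symm a ha c hc)
      (hadj s m hms.symm a ha d hd) (hadj t n hnt.symm b hb c hc)
      (hadj t m hmt.symm b hb d hd) (hadj n m hmn.symm c hc d hd) hva hvb (hn c hc) hvd
  obtain ⟨m, hm⟩ := Fin.exists_notMem_of_card_lt {s, t, n}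
    (Finset.card_le_three.trans_lt (by omega))
  simp only [Finset.mem_insert, Finset.mem_singleton, not_or] at hm
  obtain ⟨hms, hmt, hmn⟩ := hm
  obtain ⟨e, he⟩ := hA.1.1 m
  have hve := key s t m a b e hst hmn hms hmt ha hb he hva hvb
  refine hA.false_of_complete hv hn fun l hl d hd => ?_
  by_cases hls : l = s
  · subst hls
    exact key t m l b e d (Ne.symm hmt) hl hst (Ne.symm hms) hb he hd hvb hve
  by_cases hlt : l = t
  · subst hlt
    exact key s m l a e d (Ne.symm hms) hl (Ne.symm hst) (Ne.symm hmt) ha he hd hva hve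
  exact key s t l a b d hst hl hls hlt ha hb hd hva hvb

/-- Let `S` and `T` be vertex sets (neighbourhoods) each meeting at most one part of `A`. If `S`
and `T` together meet every edge of `A` avoiding the parts `i` and `j`, then `S` contains
some part of `A` other than `A i` and `A j`. -/
theorem exists_part_subset {V : Type*} {w : ℕ} (hw : 5 ≤ w) {A : Fin w → Finset V}
    (i j : Fin w) {S T : V → Prop}
    (hT : ∀ s t, ∀ a ∈ A s, ∀ b ∈ A t, T a → T b → s = t)
    (h : ∀ s t, s ≠ t → s ≠ i → s ≠ j → t ≠ i → t ≠ j → ∀ a ∈ A s, ∀ b ∈ A t,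
      ¬ S a → ¬ T a → ¬ S b → ¬ T b → False) :
    ∃ m, m ≠ i ∧ m ≠ j ∧ ∀ a ∈ A m, S a := by
  by_contra! hS
  obtain ⟨n, hn⟩ : ∃ n, ∀ m, m ≠ n → ∀ a ∈ A m, ¬ T a := by
    by_cases hex : ∃ n, ∃ b ∈ A n, T b
    · obtain ⟨n, b, hb, hTb⟩ := hex
      exact ⟨n, fun m hm a ha hTa => hm (hT m n a ha b hb hTa hTb)⟩
    · push Not at hex
      exact ⟨i, fun m _ => hex m⟩
  obtain ⟨s, hs⟩ := Fin.exists_notMem_of_card_lt {i, j, n}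
    (Finset.card_le_three.trans_lt (by omega))
  obtain ⟨t, ht⟩ := Fin.exists_notMem_of_card_lt {i, j, n, s}
    (Finset.card_le_four.trans_lt (by omega))
  simp only [Finset.mem_insert, Finset.mem_singleton, not_or] at hs ht
  obtain ⟨a, ha, hSa⟩ := hS s hs.1 hs.2.1
  obtain ⟨b, hb, hSb⟩ := hS t ht.1 ht.2.1
  exact h s t (Ne.symm ht.2.2.2) hs.1 hs.2.1 ht.1 ht.2.1 a ha b hb hSa
    (hn s hs.2.2 a ha) hSb (hn t ht.2.2.1 b hb)

/-- Property (P8).  Let `G` be `(P₂ ∪ P₄, HVN)`-free with `ω(G) = ω ≥ 5`, `A` an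
induced complete `ω`-partite subgraph of maximum order, `H` the subgraph induced
on `V(G) ∖ V(A)` with `k = ω(H) ≥ 4`, and `B` an induced complete `k`-partite
subgraph of `H` of maximum order; assume every vertex of `V(A)` has its
`B`-neighbours inside at most one part of `B`.  If `x` has all its
`A`-neighbours in `Aᵢ` and all its `B`-neighbours in `B_p` (both nonempty), `y`
has all its `A`-neighbours in `Aⱼ` and all its `B`-neighbours in `B_q` (both
nonempty), with `i ≠ j` and `p ≠ q`, then `x` and `y` are not adjacent. -/
theorem not_adj_P8 {V : Type*} [Fintype V] (G : SimpleGraph V)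
    (h1 : IsFree G P2P4) (h2 : IsFree G HVN)
    (w : ℕ) (hw : 5 ≤ w) (hGw : G.cliqueNum = w)
    (A : Fin w → Finset V) (hA : IsMaxCompMultipartite G Set.univ A)
    (k : ℕ) (hk4 : 4 ≤ k)
    (hk : (G.induce (⋃ i, (↑(A i) : Set V))ᶜ).cliqueNum = k)
    (B : Fin k → Finset V)
    (hB : IsMaxCompMultipartite G (⋃ i, (↑(A i) : Set V))ᶜ B)
    (hAB : ∀ v ∈ ⋃ i, (↑(A i) : Set V), ∀ p q : Fin k,
      (∃ b ∈ B p, G.Adj v b) → (∃ b ∈ B q, G.Adj v b) → p = q)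
    (x y : V)
    (hx : x ∉ (⋃ i, (↑(A i) : Set V)) ∪ ⋃ j, (↑(B j) : Set V))
    (hy : y ∉ (⋃ i, (↑(A i) : Set V)) ∪ ⋃ j, (↑(B j) : Set V))
    (i j : Fin w) (p q : Fin k) (hij : i ≠ j) (hpq : p ≠ q)
    (hxA : (∃ a ∈ A i, G.Adj x a) ∧
      ∀ a ∈ ⋃ t, (↑(A t) : Set V), G.Adj x a → a ∈ A i)
    (hxB : (∃ b ∈ B p, G.Adj x b) ∧
      ∀ b ∈ ⋃ t, (↑(B t) : Set V), G.Adj x b → b ∈ B p)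
    (hyA : (∃ a ∈ A j, G.Adj y a) ∧
      ∀ a ∈ ⋃ t, (↑(A t) : Set V), G.Adj y a → a ∈ A j)
    (hyB : (∃ b ∈ B q, G.Adj y b) ∧
      ∀ b ∈ ⋃ t, (↑(B t) : Set V), G.Adj y b → b ∈ B q) :
    ¬ G.Adj x y := by
  intro hxy
  have hmemA : ∀ {a t}, a ∈ A t → a ∈ ⋃ t, (↑(A t) : Set V) := fun {a t} ha =>
    Set.mem_iUnion.2 ⟨t, ha⟩
  have hmemB : ∀ {b t}, b ∈ B t → b ∈ ⋃ t, (↑(B t) : Set V) := fun {b t} hb =>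
    Set.mem_iUnion.2 ⟨t, hb⟩
  have hadjA := hA.1.2.2.2.2
  have hadjB := hB.1.2.2.2.2
  have hnadj : ∀ {n : ℕ} {C : Fin n → Finset V} {z : V} {i₀ : Fin n},
      (∀ s t, s ≠ t → Disjoint (C s) (C t)) →
      (∀ a ∈ ⋃ t, (↑(C t) : Set V), G.Adj z a → a ∈ C i₀) →
      ∀ {s a}, s ≠ i₀ → a ∈ C s → ¬ G.Adj z a := by
    intro n C z i₀ hdis hz s a hs ha hza
    exact Finset.disjoint_left.1 (hdis s i₀ hs) ha (hz a (Set.mem_iUnion.2 ⟨s, ha⟩) hza)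
  have hone : ∀ {b r}, b ∈ B r → ∀ s t, ∀ a ∈ A s, ∀ a' ∈ A t,
      G.Adj b a → G.Adj b a' → s = t := fun {b r} hb s t a ha a' ha' h h' =>
    hA.part_eq_of_adj h2 hw hGw (fun t ht => hB.1.2.1 r hb (hmemA ht)) ha ha' h h'
  obtain ⟨bp, hbp, hxbp⟩ := hxB.1
  obtain ⟨bq, hbq, hybq⟩ := hyB.1
  obtain ⟨r, hr⟩ := Fin.exists_notMem_of_card_lt {p, q}
    (Finset.card_le_two.trans_lt (by omega))
  obtain ⟨r', hr'⟩ := Fin.exists_notMem_of_card_lt {p, q, r}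
    (Finset.card_le_three.trans_lt (by omega))
  simp only [Finset.mem_insert, Finset.mem_singleton, not_or] at hr hr'
  obtain ⟨c, hc⟩ := hB.1.1 r
  obtain ⟨c', hc'⟩ := hB.1.1 r'
  have hpair : ∀ {l e}, l ≠ p → l ≠ q → e ∈ B l → ∀ s t, s ≠ t → s ≠ i → s ≠ j → t ≠ i → t ≠ j →
      ∀ a ∈ A s, ∀ b ∈ A t, ¬ G.Adj bp a → ¬ G.Adj e a → ¬ G.Adj bp b → ¬ G.Adj e b → False := by
    intro l e hlp hlq he s t hst hsi hsj hti htj a ha b hb h₁ h₂ h₃ h₄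
    exact h1.false_of_P2P4 (hadjA s t hst a ha b hb) hxy.symm hxbp
      (hadjB p l (Ne.symm hlp) bp hbp e he) (hnadj hB.1.2.2.1 hyB.2 hpq hbp)
      (hnadj hB.1.2.2.1 hyB.2 hlq he) (hnadj hB.1.2.2.1 hxB.2 hlp he)
      ⟨hnadj hA.1.2.2.1 hyA.2 hsj ha, hnadj hA.1.2.2.1 hxA.2 hsi ha, h₁, h₂⟩
      ⟨hnadj hA.1.2.2.1 hyA.2 htj hb, hnadj hA.1.2.2.1 hxA.2 hti hb, h₃, h₄⟩
  have hpair' : ∀ s t, s ≠ t → s ≠ i → s ≠ j → t ≠ i → t ≠ j →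
      ∀ a ∈ A s, ∀ b ∈ A t, ¬ G.Adj bq a → ¬ G.Adj c a → ¬ G.Adj bq b → ¬ G.Adj c b → False := by
    intro s t hst hsi hsj hti htj a ha b hb h₁ h₂ h₃ h₄
    exact h1.false_of_P2P4 (hadjA s t hst a ha b hb) hxy hybq
      (hadjB q r (Ne.symm hr.2) bq hbq c hc) (hnadj hB.1.2.2.1 hxB.2 hpq.symm hbq)
      (hnadj hB.1.2.2.1 hxB.2 hr.1 hc) (hnadj hB.1.2.2.1 hyB.2 hr.2 hc)
      ⟨hnadj hA.1.2.2.1 hxA.2 hsi ha, hnadj hA.1.2.2.1 hyA.2 hsj ha, h₁, h₂⟩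
      ⟨hnadj hA.1.2.2.1 hxA.2 hti hb, hnadj hA.1.2.2.1 hyA.2 htj hb, h₃, h₄⟩
  obtain ⟨mp, -, -, hmp⟩ := exists_part_subset hw i j (hone hc) (hpair hr.1 hr.2 hc)
  obtain ⟨mr, -, -, hmr⟩ := exists_part_subset hw i j (hone hbp)
    fun s t h₁ h₂ h₃ h₄ h₅ a ha b hb h₆ h₇ h₈ h₉ =>
      hpair hr.1 hr.2 hc s t h₁ h₂ h₃ h₄ h₅ a ha b hb h₇ h₆ h₉ h₈
  obtain ⟨ms, hsi, hsj, hms⟩ := exists_part_subset hw i j (hone hbp)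
    fun s t h₁ h₂ h₃ h₄ h₅ a ha b hb h₆ h₇ h₈ h₉ =>
      hpair hr'.1 hr'.2.1 hc' s t h₁ h₂ h₃ h₄ h₅ a ha b hb h₇ h₆ h₉ h₈
  obtain ⟨mq, hqi, hqj, hmq⟩ := exists_part_subset hw i j (hone hc) hpair'
  have hsep : ∀ {u v d e l}, d ∈ B u → e ∈ B v → u ≠ v → (∀ a ∈ A l, G.Adj d a) →
      ∀ a ∈ A l, ¬ G.Adj e a := fun {u v d e l} hd he huv hl a ha hea =>
    huv (hAB a (hmemA ha) u v ⟨d, hd, (hl a ha).symm⟩ ⟨e, he, hea.symm⟩)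
  obtain ⟨a, ha⟩ := hA.1.1 mq
  obtain ⟨b, hb⟩ := hA.1.1 ms
  have hqs : mq ≠ ms := by
    rintro rfl
    exact hsep hc' hbq hr'.2.1 hms a ha (hmq a ha)
  exact hpair hr.1 hr.2 hc mq ms hqs hqi hqj hsi hsj a ha b hb
    (hsep hbq hbp hpq.symm hmq a ha) (hsep hbq hc (Ne.symm hr.2) hmq a ha)
    (hsep hc' hbp hr'.1 hms b hb) (hsep hc' hc hr'.2.2 hms b hb)
end
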